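/- Every (P_5, HVN)-free graph G satisfies χ(G) ≤ ω(G) + 3. -/

import Mathlib

open SimpleGraph

/-- The paw: a triangle 0,1,2 plus vertex 3 adjacent only to 0. -/
def pawGraph : SimpleGraph (Fin 4) :=
  SimpleGraph.fromEdgeSet {s(0,1), s(0,2), s(1,2), s(0,3)}

/-- The HVN: a K₄ on 0,1,2,3 plus vertex 4 adjacent to exactly 0 and 1. -/
def hvnGraph : SimpleGraph (Fin 5) :=
  SimpleGraph.fromEdgeSet {s(0,1), s(0,2), s(0,3), s(1,2), s(1,3), s(2,3), s(4,0), s(4,1)}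

/-- The T-5-wheel: 5-cycle 0-1-2-3-4-0 plus vertex 5 adjacent to the three consecutive
vertices 4, 0, 1. -/
def t5WheelGraph : SimpleGraph (Fin 6) :=
  SimpleGraph.fromEdgeSet {s(0,1), s(1,2), s(2,3), s(3,4), s(4,0), s(5,4), s(5,0), s(5,1)}

/-- The Y-5-wheel: 5-cycle 0-1-2-3-4-0 plus vertex 5 adjacent to 0, 1, 3
(three non-consecutive vertices). -/
def y5WheelGraph : SimpleGraph (Fin 6) :=
  SimpleGraph.fromEdgeSet {s(0,1), s(1,2), s(2,3), s(3,4), s(4,0), s(5,0), s(5,1), s(5,3)}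

/-- `G` contains an induced copy of `H`: an injection preserving and reflecting adjacency. -/
def ContainsInduced {V W : Type*} (G : SimpleGraph V) (H : SimpleGraph W) : Prop :=
  ∃ f : W ↪ V, ∀ a b : W, H.Adj a b ↔ G.Adj (f a) (f b)

/-- `G` is `H`-free: no induced copy of `H`. -/
def InducedFree {V W : Type*} (G : SimpleGraph V) (H : SimpleGraph W) : Prop :=
  ¬ ContainsInduced G H

/-- `v` lists the vertices of an induced (chordless) 5-cycle of `G`, in order. -/
def IsInducedC5 {V : Type*} (G : SimpleGraph V) (v : ZMod 5 → V) : Prop :=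
  Function.Injective v ∧ ∀ i j : ZMod 5, G.Adj (v i) (v j) ↔ (j = i + 1 ∨ j = i - 1)


namespace HVNProof

variable {V : Type*}

/-- Usable form of `P₅`-freeness. -/
def NoP5 (G : SimpleGraph V) : Prop :=
  ∀ a b c d e : V, G.Adj a b → G.Adj b c → G.Adj c d → G.Adj d e →
    ¬ G.Adj a c → ¬ G.Adj a d → ¬ G.Adj a e → ¬ G.Adj b d → ¬ G.Adj b e → ¬ G.Adj c e → False

/-- Usable form of HVN-freeness: `a b c d` a clique, `e` adjacent to exactly `a, b`. -/
def NoHVN (G : SimpleGraph V) : Prop :=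
  ∀ a b c d e : V, G.Adj a b → G.Adj a c → G.Adj a d → G.Adj b c → G.Adj b d → G.Adj c d →
    G.Adj e a → G.Adj e b → ¬ G.Adj e c → ¬ G.Adj e d → False

/-- List colouring of the set `S`. -/
def LCol (G : SimpleGraph V) (S : Set V) (L : V → ℕ → Prop) : Prop :=
  ∃ f : V → ℕ, (∀ x ∈ S, L x (f x)) ∧ ∀ x ∈ S, ∀ y ∈ S, G.Adj x y → f x ≠ f y

/-- `S` can be coloured with `k` colours. -/
def ColOn (G : SimpleGraph V) (S : Set V) (k : ℕ) : Prop := LCol G S (fun _ c => c < k)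

/-- The connected component of `x` inside `S` (meaningful for `x ∈ S`). -/
def comp (G : SimpleGraph V) (S : Set V) (x : V) : Set V :=
  {y | Relation.ReflTransGen (fun a b => G.Adj a b ∧ a ∈ S ∧ b ∈ S) x y}

variable {G : SimpleGraph V} {S : Set V} {x y z : V}

lemma comp_self : x ∈ comp G S x := Relation.ReflTransGen.refl

lemma comp_ind {p : V → Prop} (hy : y ∈ comp G S x) (h0 : p x)
    (h : ∀ a b, a ∈ comp G S x → a ∈ S → b ∈ S → G.Adj a b → p a → p b) : p y := by
  have : y ∈ comp G S x ∧ p y := by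
    induction hy with
    | refl => exact ⟨comp_self, h0⟩
    | tail h1 h2 ih =>
      exact ⟨Relation.ReflTransGen.tail h1 h2, h _ _ ih.1 h2.2.1 h2.2.2 h2.1 ih.2⟩
  exact this.2

lemma comp_closed (hy : y ∈ comp G S x) (hyS : y ∈ S) (hz : z ∈ S) (h : G.Adj y z) :
    z ∈ comp G S x :=
  Relation.ReflTransGen.tail hy ⟨h, hyS, hz⟩

lemma comp_sub (hx : x ∈ S) (hy : y ∈ comp G S x) : y ∈ S :=
  comp_ind (p := fun y => y ∈ S) hy hx (fun _ _ _ _ hb _ _ => hb)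

lemma comp_symm (hy : y ∈ comp G S x) : x ∈ comp G S y := by
  induction hy with
  | refl => exact comp_self
  | tail h1 h2 ih => exact Relation.ReflTransGen.head ⟨h2.1.symm, h2.2.2, h2.2.1⟩ ih

lemma comp_eq (hy : y ∈ comp G S x) : comp G S y = comp G S x := by
  ext z
  exact ⟨fun h => Relation.ReflTransGen.trans hy h,
    fun h => Relation.ReflTransGen.trans (comp_symm hy) h⟩

lemma comp_iff {p : V → Prop} (hy : y ∈ comp G S x) (hz : z ∈ comp G S x)
    (h : ∀ a b, a ∈ comp G S x → b ∈ comp G S x → a ∈ S → b ∈ S → G.Adj a b → p a → p b)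
    (hp : p y) : p z := by
  have hz' : z ∈ comp G S y := by rw [comp_eq hy]; exact hz
  refine comp_ind hz' hp ?_
  intro a b ha haS hbS hab
  rw [comp_eq hy] at ha
  exact h a b ha (comp_closed ha haS hbS hab) haS hbS hab

lemma LCol.mono {L L' : V → ℕ → Prop} (h : LCol G S L) {T : Set V} (hT : T ⊆ S)
    (hL : ∀ x ∈ T, ∀ c, L x c → L' x c) : LCol G T L' := by
  obtain ⟨f, h1, h2⟩ := h
  exact ⟨f, fun x hx => hL x hx _ (h1 x (hT hx)), fun x hx y hy => h2 x (hT hx) y (hT hy)⟩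

lemma ColOn.mono {k l : ℕ} (h : ColOn G S k) {T : Set V} (hT : T ⊆ S) (hkl : k ≤ l) :
    ColOn G T l :=
  LCol.mono h hT (fun _ _ _ hc => lt_of_lt_of_le hc hkl)

lemma LCol.of_comps {L : V → ℕ → Prop} (h : ∀ x ∈ S, LCol G (comp G S x) L) : LCol G S L := by
  classical
  choose! F hF using
    (fun (P : {P : Set V // ∃ x ∈ S, P = comp G S x}) => by
      obtain ⟨P, x, hx, rfl⟩ := P
      exact h x hx : ∀ P : {P : Set V // ∃ x ∈ S, P = comp G S x}, LCol G P.1 L)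
  refine ⟨fun x => if hx : x ∈ S then F ⟨comp G S x, x, hx, rfl⟩ x else 0, ?_, ?_⟩
  · intro x hx
    simp only [hx, dif_pos]
    exact (hF ⟨comp G S x, x, hx, rfl⟩).1 x comp_self
  · intro x hx y hy hxy
    simp only [hx, hy, dif_pos]
    have hyx : y ∈ comp G S x := comp_closed comp_self hx hy hxy
    have e : (⟨comp G S y, y, hy, rfl⟩ : {P : Set V // ∃ x ∈ S, P = comp G S x})
        = ⟨comp G S x, x, hx, rfl⟩ := by
      apply Subtype.ext; exact comp_eq hyx
    rw [e]
    exact (hF ⟨comp G S x, x, hx, rfl⟩).2 x comp_self y hyx hxy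

/-- Extend a colouring `f` of `A` to `A ∪ B`. -/
lemma LCol.extend {A B : Set V} {L : V → ℕ → Prop} (f : V → ℕ) (h1 : ∀ x ∈ A, L x (f x))
    (h2 : ∀ x ∈ A, ∀ y ∈ A, G.Adj x y → f x ≠ f y)
    (hB : LCol G B (fun b c => L b c ∧ ∀ x ∈ A, G.Adj x b → f x ≠ c)) :
    LCol G (A ∪ B) L := by
  classical
  obtain ⟨g, g1, g2⟩ := hB
  refine ⟨fun x => if x ∈ A then f x else g x, ?_, ?_⟩
  · intro x hx
    by_cases hA : x ∈ A
    · simpa [hA] using h1 x hA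
    · have hxB : x ∈ B := by rcases hx with h | h; exact absurd h hA; exact h
      simpa [hA] using (g1 x hxB).1
  · intro x hx y hy hxy
    by_cases hA : x ∈ A <;> by_cases hA' : y ∈ A
    · simpa [hA, hA'] using h2 x hA y hA' hxy
    · have hyB : y ∈ B := by rcases hy with h | h; exact absurd h hA'; exact h
      simpa [hA, hA'] using (g1 y hyB).2 x hA hxy
    · have hxB : x ∈ B := by rcases hx with h | h; exact absurd h hA; exact h
      simpa [hA, hA'] using ((g1 x hxB).2 y hA' hxy.symm).symm
    · have hyB : y ∈ B := by rcases hy with h | h; exact absurd h hA'; exact h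
      have hxB : x ∈ B := by rcases hx with h | h; exact absurd h hA; exact h
      simpa [hA, hA'] using g2 x hxB y hyB hxy

lemma ColOn.union {A B : Set V} {k l : ℕ} (hA : ColOn G A k) (hB : ColOn G B l) :
    ColOn G (A ∪ B) (k + l) := by
  obtain ⟨f, f1, f2⟩ := hA
  obtain ⟨g, g1, g2⟩ := hB
  refine LCol.extend f (fun x hx => lt_of_lt_of_le (f1 x hx) (by omega)) f2 ?_
  refine ⟨fun x => k + g x, fun x hx => ⟨by have := g1 x hx; simp only at this ⊢; omega, ?_⟩, ?_⟩
  · intro y hy _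
    have := f1 y hy
    simp only at this ⊢; omega
  · intro x hx y hy hxy
    have := g2 x hx y hy hxy
    simp only
    omega

lemma ColOn.union_anti {A B : Set V} {k : ℕ} (hA : ColOn G A k) (hB : ColOn G B k)
    (h : ∀ a ∈ A, ∀ b ∈ B, ¬ G.Adj a b) : ColOn G (A ∪ B) k := by
  obtain ⟨f, f1, f2⟩ := hA
  refine LCol.extend f f1 f2 ?_
  exact LCol.mono hB le_rfl (fun x hx c hc => ⟨hc, fun y hy hyx => absurd hyx (h y hy x hx)⟩)

lemma ColOn.single (k : ℕ) (hk : 1 ≤ k) (v : V) : ColOn G {v} k :=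
  ⟨fun _ => 0, fun _ _ => by simp only; omega, by
    intro x hx y hy hxy
    simp only [Set.mem_singleton_iff] at hx hy
    subst hx hy
    exact absurd hxy G.irrefl⟩

lemma ColOn.stable {k : ℕ} (hk : 1 ≤ k) (h : ∀ x ∈ S, ∀ y ∈ S, ¬ G.Adj x y) : ColOn G S k :=
  ⟨fun _ => 0, fun _ _ => by simp only; omega, fun x hx y hy hxy => absurd hxy (h x hx y hy)⟩

/-- In a connected set `C = comp S x₀`, a nonempty closed part is everything. -/
lemma comp_cross {x₀ : V} {A : Set V} (hy : y ∈ comp G S x₀) (hyA : y ∈ A)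
    (hz : z ∈ comp G S x₀) (hzA : z ∉ A) :
    ∃ a b, a ∈ comp G S x₀ ∧ b ∈ comp G S x₀ ∧ a ∈ S ∧ b ∈ S ∧ G.Adj a b ∧ a ∈ A ∧ b ∉ A := by
  by_contra hcon
  apply hzA
  refine comp_iff (p := fun y => y ∈ A) hy hz ?_ hyA
  intro a b ha hb haS hbS hab haA
  by_contra hbA
  exact hcon ⟨a, b, ha, hb, haS, hbS, hab, haA, hbA⟩

/-- Every component of `C \ N(u)` is complete to some vertex of `C ∩ N(u)`. -/
lemma attach {u x₀ : V} {w : V} (hw : w ∈ comp G S x₀) (huw : G.Adj u w)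
    (hom : ∀ x d d', x ∈ comp G S x₀ → d ∈ comp G S x₀ → d' ∈ comp G S x₀ → G.Adj u x →
      ¬ G.Adj u d → ¬ G.Adj u d' → G.Adj d d' → G.Adj x d → G.Adj x d')
    {d : V} (hd : d ∈ comp G S x₀) (hud : ¬ G.Adj u d) :
    ∃ x ∈ comp G S x₀, G.Adj u x ∧
      ∀ d' ∈ comp G (comp G S x₀ \ {y | G.Adj u y}) d, G.Adj x d' := by
  set D := comp G S x₀ \ {y | G.Adj u y} with hD
  have hdD : d ∈ D := ⟨hd, hud⟩
  obtain ⟨a, b, ha, hb, haS, hbS, hab, haA, hbA⟩ :=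
    comp_cross (A := comp G D d) hd comp_self hw
      (fun h => (comp_sub hdD h).2 huw)
  have haD := comp_sub hdD haA
  have hub : G.Adj u b := by
    by_contra hub
    exact hbA (comp_closed haA haD ⟨hb, hub⟩ hab)
  refine ⟨b, hb, hub, ?_⟩
  intro d' hd'
  refine comp_iff (p := fun y => G.Adj b y) haA hd' ?_ hab.symm
  intro p q _ _ hp hq hpq hbp
  exact hom b p q hb hp.1 hq.1 hub hp.2 hq.2 hpq hbp

/-- If all neighbourhoods in `S` are `k`-colourable then `S` is `3k`-colourable. -/
lemma three_mul (hP : NoP5 G) {k : ℕ} (hk : 1 ≤ k)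
    (h : ∀ w ∈ S, ColOn G {y | y ∈ S ∧ G.Adj w y} k) : ColOn G S (k + (k + k)) := by
  refine LCol.of_comps ?_
  intro v hv
  set A := {y | y ∈ S ∧ G.Adj v y} with hA
  set R := {y | y ∈ comp G S v ∧ ¬ G.Adj v y ∧ y ≠ v} with hR
  have hRS : ∀ y ∈ R, y ∈ S := fun y hy => comp_sub hv hy.1
  have hcR : ColOn G R (k + k) := by
    refine LCol.of_comps ?_
    intro y hy
    set C := comp G R y with hC
    have hCR : ∀ z ∈ C, z ∈ R := fun z hz => comp_sub hy hz
    obtain ⟨a, b, ha, hb, haS, hbS, hab, haA, hbA⟩ :=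
      comp_cross (A := C) hy.1 comp_self (comp_self : v ∈ comp G S v)
        (fun h => (hCR _ h).2.2 rfl)
    have haR := hCR a haA
    have hvb : G.Adj v b := by
      by_contra hvb
      by_cases hbv : b = v
      · subst hbv; exact haR.2.1 hab.symm
      · exact hbA (comp_closed haA haR ⟨hb, hvb, hbv⟩ hab)
    have hom : ∀ x d d', x ∈ C → d ∈ C → d' ∈ C → G.Adj b x →
      ¬ G.Adj b d → ¬ G.Adj b d' → G.Adj d d' → G.Adj x d → G.Adj x d' := by
      intro x d d' hx hd hd' hbx hbd hbd' hdd hxd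
      by_contra hxd'
      exact hP v b x d d' hvb hbx hxd hdd (hCR _ hx).2.1 (hCR _ hd).2.1 (hCR _ hd').2.1
        hbd hbd' hxd'
    have hX : ColOn G {z | z ∈ S ∧ G.Adj b z} k := h b hbS
    have hD : ColOn G (C \ {z | G.Adj b z}) k := by
      refine LCol.of_comps ?_
      intro d hd
      obtain ⟨x, hx, hbx, hxd⟩ := attach haA hab.symm hom hd.1 hd.2
      refine ColOn.mono (h x (hRS _ (hCR _ hx))) ?_ le_rfl
      intro z hz
      exact ⟨hRS _ (hCR _ (comp_sub hd hz).1), hxd z hz⟩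
    refine ColOn.mono (hX.union hD) ?_ le_rfl
    intro z hz
    by_cases hbz : G.Adj b z
    · exact Or.inl ⟨hRS _ (hCR _ hz), hbz⟩
    · exact Or.inr ⟨hz, hbz⟩
  have hvR : ColOn G ({v} ∪ R) (k + k) := by
    refine ColOn.union_anti (ColOn.single _ (by omega) v) hcR ?_
    intro a ha b hb
    rw [Set.mem_singleton_iff] at ha
    subst ha
    exact hb.2.1
  refine ColOn.mono ((h v hv).union hvR) ?_ le_rfl
  intro z hz
  by_cases h1 : G.Adj v z
  · exact Or.inl ⟨comp_sub hv hz, h1⟩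
  · by_cases h2 : z = v
    · exact Or.inr (Or.inl h2)
    · exact Or.inr (Or.inr ⟨hz, h1, h2⟩)

/-- Triangle-freeness of a set. -/
def TriFree (G : SimpleGraph V) (S : Set V) : Prop :=
  ∀ a ∈ S, ∀ b ∈ S, ∀ c ∈ S, G.Adj a b → G.Adj a c → G.Adj b c → False

lemma TriFree.col3 (hP : NoP5 G) (h : TriFree G S) : ColOn G S 3 := by
  refine three_mul (k := 1) hP le_rfl ?_
  intro w hw
  refine ColOn.stable le_rfl ?_
  intro x hx y hy hxy
  exact h w hw x hx.1 y hy.1 hx.2 hy.2 hxy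

/-- A 5-cycle in `S`, induced. -/
def HasC5 (G : SimpleGraph V) (S : Set V) : Prop :=
  ∃ f : ZMod 5 → V, (∀ i, f i ∈ S) ∧ ∀ i j, G.Adj (f i) (f j) ↔ (j = i + 1 ∨ j = i - 1)

lemma mkC5 {a b c d e : V} (ha : a ∈ S) (hb : b ∈ S) (hc : c ∈ S) (hd : d ∈ S) (he : e ∈ S)
    (h1 : G.Adj a b) (h2 : G.Adj b c) (h3 : G.Adj c d) (h4 : G.Adj d e) (h5 : G.Adj e a)
    (n1 : ¬ G.Adj a c) (n2 : ¬ G.Adj b d) (n3 : ¬ G.Adj c e) (n4 : ¬ G.Adj d a)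
    (n5 : ¬ G.Adj e b) : HasC5 G S := by
  refine ⟨(![a, b, c, d, e] : Fin 5 → V), ?_, ?_⟩
  · intro i
    change Fin 5 at i
    fin_cases i <;> assumption
  · intro i j
    change Fin 5 at i j
    change G.Adj ((![a, b, c, d, e] : Fin 5 → V) i) ((![a, b, c, d, e] : Fin 5 → V) j) ↔
      (j = i + 1 ∨ j = i - 1)
    have g1 := h1.symm; have g2 := h2.symm; have g3 := h3.symm; have g4 := h4.symm
    have g5 := h5.symm
    have m1 := fun h => n1 (G.adj_symm h); have m2 := fun h => n2 (G.adj_symm h)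
    have m3 := fun h => n3 (G.adj_symm h); have m4 := fun h => n4 (G.adj_symm h)
    have m5 := fun h => n5 (G.adj_symm h)
    fin_cases i <;> fin_cases j <;>
      first
      | exact iff_of_true (by assumption) (by decide)
      | exact iff_of_false (by first | assumption | exact G.irrefl) (by decide)

lemma bip (hP : NoP5 G) (h3 : TriFree G S) (h5 : ¬ HasC5 G S) : ColOn G S 2 := by
  classical
  refine LCol.of_comps ?_
  intro v hv
  have hsub : ∀ y ∈ comp G S v, y ∈ S := fun y hy => comp_sub hv hy
  -- second level
  set L2 : V → Prop := fun y => y ∈ S ∧ y ≠ v ∧ ¬ G.Adj v y ∧ ∃ a ∈ S, G.Adj v a ∧ G.Adj a y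
    with hL2
  have key : ∀ y ∈ comp G S v, y = v ∨ G.Adj v y ∨ L2 y ∨ ∃ p, L2 p ∧ G.Adj p y := by
    intro y hy
    refine comp_ind (p := fun y => y = v ∨ G.Adj v y ∨ L2 y ∨ ∃ p, L2 p ∧ G.Adj p y) hy
      (Or.inl rfl) ?_
    intro a b ha haS hbS hab hpa
    by_cases hbv : b = v
    · exact Or.inl hbv
    by_cases hvb : G.Adj v b
    · exact Or.inr (Or.inl hvb)
    rcases hpa with rfl | h | h | ⟨p, hp, hpa⟩
    · exact absurd hab hvb
    · exact Or.inr (Or.inr (Or.inl ⟨hbS, hbv, hvb, a, haS, h, hab⟩))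
    · exact Or.inr (Or.inr (Or.inr ⟨a, h, hab⟩))
    · by_cases hva : G.Adj v a
      · exact Or.inr (Or.inr (Or.inl ⟨hbS, hbv, hvb, a, haS, hva, hab⟩))
      by_cases hL : ∃ q, L2 q ∧ G.Adj q b
      · exact Or.inr (Or.inr (Or.inr hL))
      by_cases hLb : L2 b
      · exact Or.inr (Or.inr (Or.inl hLb))
      exfalso
      obtain ⟨hpS, hpv, hvp, c, hcS, hvc, hcp⟩ := hp
      have hca : ¬ G.Adj c a := fun hca => h3 c hcS p hpS a haS hcp hca hpa
      have hcb : ¬ G.Adj c b := fun hcb => hLb ⟨hbS, hbv, hvb, c, hcS, hvc, hcb⟩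
      have hpb : ¬ G.Adj p b := fun hpb => hL ⟨p, ⟨hpS, hpv, hvp, c, hcS, hvc, hcp⟩, hpb⟩
      exact hP v c p a b hvc hcp hpa hab hvp hva hvb hca hcb hpb
  have st2 : ∀ x y, L2 x → L2 y → ¬ G.Adj x y := by
    rintro x y ⟨hxS, hxv, hvx, a, haS, hva, hax⟩ ⟨hyS, hyv, hvy, b, hbS, hvb, hby⟩ hxy
    have n1 : ¬ G.Adj a y := fun h => h3 a haS x hxS y hyS hax h hxy
    have n2 : ¬ G.Adj x b := fun h => h3 b hbS x hxS y hyS h.symm hby hxy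
    have n3 : ¬ G.Adj b a := fun h => h3 v hv a haS b hbS hva hvb h.symm
    exact h5 (mkC5 hv haS hxS hyS hbS hva hax hxy hby.symm hvb.symm hvx n1 n2
      (fun h => hvy h.symm) n3)
  refine ⟨fun y => if y = v ∨ L2 y then 0 else 1, fun y _ => by
    simp only; split_ifs <;> omega, ?_⟩
  intro x hx y hy hxy
  by_cases cx : x = v ∨ L2 x <;> by_cases cy : y = v ∨ L2 y
  · exfalso
    rcases cx with rfl | cx <;> rcases cy with rfl | cy
    · exact G.irrefl hxy
    · exact cy.2.2.1 hxy
    · exact cx.2.2.1 hxy.symm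
    · exact st2 x y cx cy hxy
  · simp [cx, cy]
  · simp [cx, cy]
  · exfalso
    push Not at cx cy
    have kx := key x hx
    have ky := key y hy
    have hxS := hsub x hx
    have hyS := hsub y hy
    by_cases hvx : G.Adj v x
    · by_cases hvy : G.Adj v y
      · exact h3 v hv x hxS y hyS hvx hvy hxy
      · exact cy.2 ⟨hyS, cy.1, hvy, x, hxS, hvx, hxy⟩
    · by_cases hvy : G.Adj v y
      · exact cx.2 ⟨hxS, cx.1, hvx, y, hyS, hvy, hxy.symm⟩
      · rcases kx with h | h | h | ⟨p, ⟨hpS, hpv, hvp, a, haS, hva, hap⟩, hpx⟩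
        · exact cx.1 h
        · exact hvx h
        · exact cx.2 h
        · have hax : ¬ G.Adj a x := fun h => cx.2 ⟨hxS, cx.1, hvx, a, haS, hva, h⟩
          have hay : ¬ G.Adj a y := fun h => cy.2 ⟨hyS, cy.1, hvy, a, haS, hva, h⟩
          have hpy : ¬ G.Adj p y := fun h => h3 p hpS x hxS y hyS hpx h hxy
          exact hP v a p x y hva hap hpx hxy hvp hvx hvy hax hay hpy

end HVNProof


namespace HVNProof

variable {V : Type*} {G : SimpleGraph V} {S : Set V} {x y z : V}

/-- Paw-freeness of a set. -/
def PawFree (G : SimpleGraph V) (S : Set V) : Prop :=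
  ∀ a ∈ S, ∀ b ∈ S, ∀ c ∈ S, ∀ d ∈ S, G.Adj a b → G.Adj a c → G.Adj b c → G.Adj d a →
    ¬ G.Adj d b → ¬ G.Adj d c → False

lemma PawFree.mono {T : Set V} (h : PawFree G S) (hT : T ⊆ S) : PawFree G T :=
  fun a ha b hb c hc d hd => h a (hT ha) b (hT hb) c (hT hc) d (hT hd)

lemma PawFree.two {x₀ a b c : V} (h : PawFree G S) (hx₀ : x₀ ∈ S) (ha : a ∈ comp G S x₀)
    (hb : b ∈ comp G S x₀) (hc : c ∈ comp G S x₀) (hab : G.Adj a b) (hac : G.Adj a c)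
    (hbc : G.Adj b c) (hy : y ∈ comp G S x₀) :
    (G.Adj y a ∧ G.Adj y b) ∨ (G.Adj y a ∧ G.Adj y c) ∨ (G.Adj y b ∧ G.Adj y c) := by
  refine comp_iff (p := fun y => (G.Adj y a ∧ G.Adj y b) ∨ (G.Adj y a ∧ G.Adj y c) ∨
    (G.Adj y b ∧ G.Adj y c)) ha hy ?_ (Or.inr (Or.inr ⟨hab, hac⟩))
  intro p q _ _ hp hq hpq hh
  have haS := comp_sub hx₀ ha
  have hbS := comp_sub hx₀ hb
  have hcS := comp_sub hx₀ hc
  have ia := h a haS b hbS c hcS q hq hab hac hbc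
  have ib := h b hbS a haS c hcS q hq hab.symm hbc hac
  have ic := h c hcS a haS b hbS q hq hac.symm hbc.symm hab
  have key : G.Adj q a ∨ G.Adj q b ∨ G.Adj q c := by
    by_contra hcon
    push Not at hcon
    rcases hh with hh | hh | hh
    · exact h p hp a haS b hbS q hq hh.1 hh.2 hab hpq.symm hcon.1 hcon.2.1
    · exact h p hp a haS c hcS q hq hh.1 hh.2 hac hpq.symm hcon.1 hcon.2.2
    · exact h p hp b hbS c hcS q hq hh.1 hh.2 hbc hpq.symm hcon.2.1 hcon.2.2
  tauto

lemma PawFree.multi {x₀ : V} (h : PawFree G S) (hx₀ : x₀ ∈ S)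
    (ht : ¬ TriFree G (comp G S x₀)) :
    ∀ x ∈ comp G S x₀, ∀ y ∈ comp G S x₀, ∀ z ∈ comp G S x₀,
      ¬ G.Adj x y → ¬ G.Adj y z → ¬ G.Adj x z := by
  intro x hx y hy z hz hxy hyz hxz
  unfold TriFree at ht
  push Not at ht
  obtain ⟨a, ha, b, hb, c, hc, hab, hac, hbc, -⟩ := ht
  have tx := h.two hx₀ ha hb hc hab hac hbc hx
  have tz := h.two hx₀ ha hb hc hab hac hbc hz
  have : ∃ w ∈ comp G S x₀, G.Adj x w ∧ G.Adj z w := by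
    by_cases h1 : G.Adj x a ∧ G.Adj z a
    · exact ⟨a, ha, h1⟩
    by_cases h2 : G.Adj x b ∧ G.Adj z b
    · exact ⟨b, hb, h2⟩
    · exact ⟨c, hc, by tauto⟩
  obtain ⟨w, hw, hxw, hzw⟩ := this
  have ty := h.two hx₀ hx hz hw hxz hxw hzw hy
  have hyx : ¬ G.Adj y x := fun h => hxy h.symm
  tauto

lemma cliqueFreeOn_nbr {n : ℕ} (h : G.CliqueFree (n + 1)) {u : V} {P : Set V}
    (hu : ∀ x ∈ P, G.Adj u x) : G.CliqueFreeOn P n := by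
  classical
  intro t ht hc
  refine h (insert u t) (hc.insert ?_)
  intro b hb
  exact hu b (ht hb)

lemma multi_col {P : Set V} {k : ℕ}
    (h : ∀ x ∈ P, ∀ y ∈ P, ∀ z ∈ P, ¬ G.Adj x y → ¬ G.Adj y z → ¬ G.Adj x z)
    (hk : G.CliqueFreeOn P (k + 1)) :
    ∃ g : V → ℕ, (∀ x ∈ P, g x < k) ∧ ∀ x ∈ P, ∀ y ∈ P, (G.Adj x y ↔ g x ≠ g y) := by
  classical
  have hm : (G.induce P).IsCompleteMultipartite :=
    ⟨fun a b c hab hbc => h a a.2 b b.2 c c.2 hab hbc⟩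
  have hcf : (G.induce P).CliqueFree (k + 1) := by
    intro t ht
    refine hk (t := t.map ⟨Subtype.val, Subtype.val_injective⟩) ?_ ?_
    · intro x hx
      simp only [Finset.coe_map, Set.mem_image] at hx
      obtain ⟨y, _, rfl⟩ := hx
      exact y.2
    · constructor
      · intro x hx y hy hxy
        simp only [Finset.coe_map, Set.mem_image] at hx hy
        obtain ⟨x', hx', rfl⟩ := hx
        obtain ⟨y', hy', rfl⟩ := hy
        exact ht.1 hx' hy' (fun h => hxy (by rw [h]))
      · rw [Finset.card_map]; exact ht.2
  obtain ⟨C⟩ := hm.colorable_of_cliqueFree hcf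
  let rep : P → P := fun x => (Quotient.mk hm.setoid x).out
  have hrep : ∀ x : P, ¬ G.Adj (rep x) x := fun x => by
    have h1 : hm.setoid.r (rep x) x := Quotient.exact (s := hm.setoid) (Quotient.out_eq _)
    exact h1
  have hrep2 : ∀ x y : P, ¬ G.Adj x y → rep x = rep y := fun x y hxy => by
    have : (Quotient.mk hm.setoid x) = Quotient.mk hm.setoid y := Quotient.sound hxy
    simp only [rep, this]
  refine ⟨fun x => if hx : x ∈ P then (C (rep ⟨x, hx⟩) : ℕ) else 0, ?_, ?_⟩
  · intro x hx
    simp only [hx, dif_pos]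
    exact (C _).2
  · intro x hx y hy
    simp only [hx, hy, dif_pos]
    constructor
    · intro hxy heq
      have : ¬ G.Adj (rep ⟨x, hx⟩ : V) (rep ⟨y, hy⟩) := by
        intro hadj
        exact C.valid (v := rep ⟨x, hx⟩) (w := rep ⟨y, hy⟩) hadj (Fin.ext heq)
      have h1 := hrep ⟨x, hx⟩
      have h2 := hrep ⟨y, hy⟩
      have h3 := h _ (rep ⟨x, hx⟩).2 _ (rep ⟨y, hy⟩).2 y hy this h2
      exact h x hx _ (rep ⟨x, hx⟩).2 y hy (fun h => h1 h.symm) h3 hxy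
    · intro hne
      by_contra hxy
      exact hne (by rw [hrep2 ⟨x, hx⟩ ⟨y, hy⟩ hxy])

lemma type_aux_bool : ∀ p : ZMod 5 → Bool, (∀ j, ¬ (p j = true ∧ p (j + 1) = true)) →
    (∀ j, p j = true → p (j + 2) = true ∨ p (j + 3) = true) → (∃ j, p j = true) →
    ∃ i, ∀ j, p j = true ↔ (j = i + 1 ∨ j = i - 1) := by
  decide +kernel

lemma type_aux (p : ZMod 5 → Prop) (h1 : ∀ j, ¬ (p j ∧ p (j + 1)))
    (h2 : ∀ j, p j → p (j + 2) ∨ p (j + 3)) (h3 : ∃ j, p j) :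
    ∃ i, ∀ j, p j ↔ (j = i + 1 ∨ j = i - 1) := by
  classical
  have := type_aux_bool (fun j => decide (p j)) (by simpa using h1) (by simpa using h2)
    (by simpa using h3)
  simpa using this

lemma z5a : ∀ i : ZMod 5, ¬ (i + 2 = i + 1 ∨ i + 2 = i - 1) ∧ ¬ (i + 3 = i + 1 ∨ i + 3 = i - 1) := by
  decide

lemma c5_facts {f : ZMod 5 → V} (hf : ∀ i j, G.Adj (f i) (f j) ↔ (j = i + 1 ∨ j = i - 1)) :
    (∀ i, G.Adj (f i) (f (i + 1))) ∧ (∀ i, ¬ G.Adj (f i) (f (i + 2))) ∧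
    (∀ i, ¬ G.Adj (f i) (f (i + 3))) ∧ (∀ i, G.Adj (f i) (f (i + 4))) := by
  refine ⟨fun i => ?_, fun i => ?_, fun i => ?_, fun i => ?_⟩ <;> rw [hf] <;>
    revert i <;> decide

lemma c5_type (hP : NoP5 G) {f : ZMod 5 → V}
    (hf : ∀ i j, G.Adj (f i) (f j) ↔ (j = i + 1 ∨ j = i - 1))
    (h1 : ∀ j, ¬ (G.Adj x (f j) ∧ G.Adj x (f (j + 1)))) (h3 : ∃ j, G.Adj x (f j)) :
    ∃ i, ∀ j, G.Adj x (f j) ↔ (j = i + 1 ∨ j = i - 1) := by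
  refine type_aux _ h1 ?_ h3
  intro j hj
  by_contra hcon
  push Not at hcon
  obtain ⟨a1, a2, a3, a4⟩ := c5_facts hf
  have e1 : j + 1 + 1 = j + 2 := by ring
  have e2 : j + 2 + 1 = j + 3 := by ring
  have e3 : j + 1 + 2 = j + 3 := by ring
  exact hP x (f j) (f (j + 1)) (f (j + 2)) (f (j + 3)) hj (a1 j) (e1 ▸ a1 (j + 1))
    (e2 ▸ a1 (j + 2)) (fun h => h1 j ⟨hj, h⟩) hcon.1 hcon.2 (a2 j) (a3 j) (e3 ▸ a2 (j + 1))

lemma c5_blow {x₀ : V} (hP : NoP5 G) (h3 : TriFree G (comp G S x₀))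
    (h5 : HasC5 G (comp G S x₀)) :
    ∃ φ : V → ZMod 5, ∀ x ∈ comp G S x₀, ∀ y ∈ comp G S x₀,
      (G.Adj x y ↔ (φ y = φ x + 1 ∨ φ y = φ x - 1)) := by
  classical
  obtain ⟨f, hfS, hf⟩ := h5
  obtain ⟨a1, a2, a3, a4⟩ := c5_facts hf
  have noedge : ∀ x ∈ comp G S x₀, ∀ j, ¬ (G.Adj x (f j) ∧ G.Adj x (f (j + 1))) := by
    intro x hx j hh
    exact h3 x hx _ (hfS j) _ (hfS (j + 1)) hh.1 hh.2 (a1 j)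
  have hit : ∀ y ∈ comp G S x₀, ∃ j, G.Adj y (f j) := by
    intro y hy
    refine comp_iff (p := fun y => ∃ j, G.Adj y (f j)) (hfS 0) hy ?_ ⟨1, by simpa using a1 0⟩
    intro p q hpc hqc _ _ hpq hp
    by_contra hq
    push Not at hq
    obtain ⟨i, hi⟩ := c5_type hP hf (noedge p hpc) hp
    have n2 : ¬ G.Adj p (f (i + 2)) := by rw [hi]; exact (z5a i).1
    have n3 : ¬ G.Adj p (f (i + 3)) := by rw [hi]; exact (z5a i).2
    have e1 : i + 1 + 1 = i + 2 := by ring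
    have e2 : i + 2 + 1 = i + 3 := by ring
    have e3 : i + 1 + 2 = i + 3 := by ring
    exact hP q p (f (i + 1)) (f (i + 2)) (f (i + 3)) hpq.symm ((hi _).2 (Or.inl rfl))
      (e1 ▸ a1 (i + 1)) (e2 ▸ a1 (i + 2)) (hq _) (hq _) (hq _) n2 n3 (e3 ▸ a2 (i + 1))
  have hty : ∀ y : V, ∃ i, y ∈ comp G S x₀ → ∀ j, G.Adj y (f j) ↔ (j = i + 1 ∨ j = i - 1) := by
    intro y
    by_cases hy : y ∈ comp G S x₀
    · obtain ⟨i, hi⟩ := c5_type hP hf (noedge y hy) (hit y hy)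
      exact ⟨i, fun _ => hi⟩
    · exact ⟨0, fun h => absurd h hy⟩
  choose φ hφ using hty
  refine ⟨φ, ?_⟩
  have succ : ∀ x ∈ comp G S x₀, ∀ y ∈ comp G S x₀, φ y = φ x + 1 → G.Adj x y := by
    intro x hx y hy h
    by_contra hxy
    have hx' := hφ x hx
    have hy' := hφ y hy
    -- x - f(i+4) - f(i+3) - f(i+2) - y
    have e1 : φ x + 2 + 1 = φ x + 3 := by ring
    have e2 : φ x + 3 + 1 = φ x + 4 := by ring
    have e3 : φ x + 2 + 2 = φ x + 4 := by ring
    refine hP x (f (φ x + 4)) (f (φ x + 3)) (f (φ x + 2)) y ?_ ?_ ?_ ?_ ?_ ?_ hxy ?_ ?_ ?_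
    · rw [hx']; generalize φ x = i; revert i; decide
    · exact (e2 ▸ a1 (φ x + 3)).symm
    · exact (e1 ▸ a1 (φ x + 2)).symm
    · rw [G.adj_comm, hy', h]; generalize φ x = i; revert i; decide
    · rw [hx']; generalize φ x = i; revert i; decide
    · rw [hx']; generalize φ x = i; revert i; decide
    · exact fun h => (e3 ▸ a2 (φ x + 2)) h.symm
    · rw [G.adj_comm, hy', h]; generalize φ x = i; revert i; decide
    · rw [G.adj_comm, hy', h]; generalize φ x = i; revert i; decide
  intro x hx y hy
  constructor
  · intro hxy
    by_contra hcon
    have : ∃ j, (j = φ x + 1 ∨ j = φ x - 1) ∧ (j = φ y + 1 ∨ j = φ y - 1) := by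
      revert hcon
      generalize φ x = i
      generalize φ y = k
      revert i k
      decide
    obtain ⟨j, hj1, hj2⟩ := this
    exact h3 x hx y hy (f j) (hfS j) hxy ((hφ x hx j).2 hj1) ((hφ y hy j).2 hj2)
  · rintro (h | h)
    · exact succ x hx y hy h
    · exact (succ y hy x hx (by rw [h]; ring)).symm

end HVNProof


namespace HVNProof

variable {V : Type*} {G : SimpleGraph V} {S : Set V} {x y z : V}

lemma glue {Φ : Set V → (V → ℕ) → Prop} (h : ∀ x ∈ S, ∃ g, Φ (comp G S x) g) :
    ∃ col : V → ℕ, ∀ x ∈ S, ∃ g, Φ (comp G S x) g ∧ ∀ y ∈ comp G S x, col y = g y := by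
  classical
  choose! F hF using
    (fun (P : {P : Set V // ∃ x ∈ S, P = comp G S x}) => by
      obtain ⟨P, x, hx, rfl⟩ := P
      exact h x hx : ∀ P : {P : Set V // ∃ x ∈ S, P = comp G S x}, ∃ g, Φ P.1 g)
  refine ⟨fun x => if hx : x ∈ S then F ⟨comp G S x, x, hx, rfl⟩ x else 0, ?_⟩
  intro x hx
  refine ⟨F ⟨comp G S x, x, hx, rfl⟩, hF ⟨comp G S x, x, hx, rfl⟩, ?_⟩
  intro y hyx
  have hy := comp_sub hx hyx
  have e : (⟨comp G S y, y, hy, rfl⟩ : {P : Set V // ∃ x ∈ S, P = comp G S x})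
      = ⟨comp G S x, x, hx, rfl⟩ := by
    apply Subtype.ext; exact comp_eq hyx
  simp only [hy, dif_pos]
  rw [e]

/-- Vertices of `P` with a neighbour in `Y` that also sees `X` outside `P`. -/
def Bad (G : SimpleGraph V) (X Y P : Set V) (c : V) : Prop :=
  ∃ q ∈ Y, G.Adj q c ∧ ∃ x ∈ X, x ∉ P ∧ G.Adj q x

lemma bad_stable (hP : NoP5 G) {X Y : Set V}
    (h1 : ∀ q ∈ Y, ∀ x ∈ X, ∀ x' ∈ X, G.Adj q x → G.Adj q x' → ¬ G.Adj x x')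
    (h2 : ∀ q ∈ Y, ∀ q' ∈ Y, G.Adj q q' → ∀ x ∈ X, G.Adj q x → G.Adj q' x)
    {x₀ : V} (hx₀ : x₀ ∈ X) (h2c : ¬ ColOn G (comp G X x₀) 2) :
    ∀ c1 ∈ comp G X x₀, ∀ c2 ∈ comp G X x₀, Bad G X Y (comp G X x₀) c1 →
      Bad G X Y (comp G X x₀) c2 → ¬ G.Adj c1 c2 := by
  classical
  rintro c1 hc1 c2 hc2 ⟨q1, hq1, hqc1, x, hx, hxP, hqx⟩ ⟨q2, hq2, hqc2, -⟩ hcc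
  have sub : ∀ c ∈ comp G X x₀, c ∈ X := fun c hc => comp_sub hx₀ hc
  have nx : ∀ c ∈ comp G X x₀, ¬ G.Adj c x := fun c hc h =>
    hxP (comp_closed hc (sub c hc) hx h)
  have n1 : ¬ G.Adj q1 c2 := fun h => h1 q1 hq1 c1 (sub _ hc1) c2 (sub _ hc2) hqc1 h hcc
  have n2 : ¬ G.Adj q2 c1 := fun h => h1 q2 hq2 c1 (sub _ hc1) c2 (sub _ hc2) h hqc2 hcc
  have n3 : ¬ G.Adj q1 q2 := fun h => n2 (h2 q1 hq1 q2 hq2 h c1 (sub _ hc1) hqc1)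
  by_cases hxq : G.Adj x q2
  · apply h2c
    have key : ∀ c ∈ comp G X x₀, (G.Adj c q1 ∧ ¬ G.Adj c q2) ∨ (G.Adj c q2 ∧ ¬ G.Adj c q1) := by
      intro c hc
      refine comp_iff (p := fun c => (G.Adj c q1 ∧ ¬ G.Adj c q2) ∨ (G.Adj c q2 ∧ ¬ G.Adj c q1))
        hc1 hc ?_ (Or.inl ⟨hqc1.symm, fun h => n2 h.symm⟩)
      intro a b ha hb haX hbX hab hpa
      rcases hpa with ⟨p1, p2⟩ | ⟨p1, p2⟩
      · have m1 : ¬ G.Adj b q1 := fun h => h1 q1 hq1 a haX b hbX p1.symm h.symm hab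
        refine Or.inr ⟨?_, m1⟩
        by_contra m2
        exact hP b a q1 x q2 hab.symm p1 hqx hxq m1 (nx b hb) m2 (nx a ha) p2 n3
      · have m1 : ¬ G.Adj b q2 := fun h => h1 q2 hq2 a haX b hbX p1.symm h.symm hab
        refine Or.inl ⟨?_, m1⟩
        by_contra m2
        exact hP b a q2 x q1 hab.symm p1 hxq.symm hqx.symm m1 (nx b hb) m2 (nx a ha) p2
          (fun h => n3 h.symm)
    refine ⟨fun c => if G.Adj c q1 then 0 else 1, fun c _ => by simp only; split_ifs <;> omega, ?_⟩
    intro a ha b hb hab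
    by_cases a1 : G.Adj a q1 <;> by_cases b1 : G.Adj b q1
    · exact absurd hab (h1 q1 hq1 a (sub _ ha) b (sub _ hb) a1.symm b1.symm)
    · simp [a1, b1]
    · simp [a1, b1]
    · have a2 : G.Adj a q2 := by have := key a ha; tauto
      have b2 : G.Adj b q2 := by have := key b hb; tauto
      exact absurd hab (h1 q2 hq2 a (sub _ ha) b (sub _ hb) a2.symm b2.symm)
  · exact hP x q1 c1 c2 q2 hqx.symm hqc1 hcc hqc2.symm (fun h => nx _ hc1 h.symm)
      (fun h => nx _ hc2 h.symm) hxq n1 n3 (fun h => n2 h.symm)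

lemma z5_stable_bool : ∀ p : ZMod 5 → Bool, (∀ j, ¬ (p j = true ∧ p (j + 1) = true)) →
    ∃ i, ∀ j, p j = true → (j = i ∨ j = i + 2) := by
  decide +kernel

lemma z5_stable (p : ZMod 5 → Prop) (h1 : ∀ j, ¬ (p j ∧ p (j + 1))) :
    ∃ i, ∀ j, p j → (j = i ∨ j = i + 2) := by
  classical
  have := z5_stable_bool (fun j => decide (p j)) (by simpa using h1)
  simpa using this

/-- A colouring of the 5-cycle. -/
def c5col (i j : ZMod 5) : ℕ :=
  if j = i then 0 else if j = i + 2 then 0 else if j = i + 4 then 2 else 1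

lemma c5col_lt (i j : ZMod 5) : c5col i j < 3 := by
  unfold c5col; split_ifs <;> omega

lemma c5col_ne : ∀ i j : ZMod 5, c5col i j ≠ c5col i (j + 1) := by decide

lemma comp_good (hP : NoP5 G) {X Y : Set V} {k : ℕ} (hk : 3 ≤ k) (hpaw : PawFree G X)
    (hcf : G.CliqueFreeOn X (k + 1))
    (h1 : ∀ q ∈ Y, ∀ x ∈ X, ∀ x' ∈ X, G.Adj q x → G.Adj q x' → ¬ G.Adj x x')
    (h2 : ∀ q ∈ Y, ∀ q' ∈ Y, G.Adj q q' → ∀ x ∈ X, G.Adj q x → G.Adj q' x)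
    {x₀ : V} (hx₀ : x₀ ∈ X) :
    ∃ g : V → ℕ, (∀ x ∈ comp G X x₀, g x < k) ∧
      (∀ x ∈ comp G X x₀, ∀ y ∈ comp G X x₀, G.Adj x y → g x ≠ g y) ∧
      (∀ c ∈ comp G X x₀, Bad G X Y (comp G X x₀) c → g c < 2) ∧
      ∀ q ∈ Y, ∃ a b, ∀ x ∈ comp G X x₀, G.Adj q x → g x = a ∨ g x = b := by
  classical
  have sub : ∀ c ∈ comp G X x₀, c ∈ X := fun c hc => comp_sub hx₀ hc
  by_cases h2c : ColOn G (comp G X x₀) 2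
  · obtain ⟨g, g1, g2⟩ := h2c
    refine ⟨g, fun x hx => by have := g1 x hx; simp only at this; omega, g2,
      fun c hc _ => g1 c hc, fun q _ => ⟨0, 1, fun x hx _ => ?_⟩⟩
    have := g1 x hx; simp only at this; omega
  have hst := bad_stable hP h1 h2 hx₀ h2c
  by_cases ht : TriFree G (comp G X x₀)
  · have h5 : HasC5 G (comp G X x₀) := by
      by_contra h5
      exact h2c (bip hP ht h5)
    obtain ⟨φ, hφ⟩ := c5_blow hP ht h5
    obtain ⟨i, hi⟩ := z5_stable
      (fun j => ∃ c ∈ comp G X x₀, Bad G X Y (comp G X x₀) c ∧ φ c = j) (by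
        rintro j ⟨⟨c, hc, hb, rfl⟩, ⟨c', hc', hb', e⟩⟩
        exact hst c hc c' hc' hb hb' ((hφ c hc c' hc').2 (Or.inl e)))
    refine ⟨fun c => c5col i (φ c), fun x _ => lt_of_lt_of_le (c5col_lt _ _) hk, ?_, ?_, ?_⟩
    · intro x hx y hy hxy
      rcases (hφ x hx y hy).1 hxy with h | h
      · simp only [h]; exact c5col_ne _ _
      · have h' : φ x = φ y + 1 := by rw [h]; ring
        simp only [h']; exact (c5col_ne _ _).symm
    · intro c hc hb
      rcases hi (φ c) ⟨c, hc, hb, rfl⟩ with h | h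
      · simp only [h]; unfold c5col; simp
      · simp only [h]; unfold c5col; simp
    · intro q hq
      obtain ⟨i', hi'⟩ := z5_stable
        (fun j => ∃ c ∈ comp G X x₀, G.Adj q c ∧ φ c = j) (by
          rintro j ⟨⟨c, hc, hb, rfl⟩, ⟨c', hc', hb', e⟩⟩
          exact h1 q hq c (sub _ hc) c' (sub _ hc') hb hb' ((hφ c hc c' hc').2 (Or.inl e)))
      refine ⟨c5col i i', c5col i (i' + 2), ?_⟩
      intro x hx hqx
      rcases hi' (φ x) ⟨x, hx, hqx, rfl⟩ with h | h
      · left; simp only [h]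
      · right; simp only [h]
  · have hm := hpaw.multi hx₀ ht
    have hcf' : G.CliqueFreeOn (comp G X x₀) (k + 1) := hcf.subset _ sub
    obtain ⟨g, g1, g2⟩ := multi_col hm hcf'
    have two : ∀ σ : Equiv.Perm ℕ, ∀ q ∈ Y, ∃ a b, ∀ x ∈ comp G X x₀, G.Adj q x →
        σ (g x) = a ∨ σ (g x) = b := by
      intro σ q hq
      by_cases hex : ∃ x ∈ comp G X x₀, G.Adj q x
      · obtain ⟨x, hx, hqx⟩ := hex
        refine ⟨σ (g x), 0, fun y hy hqy => Or.inl ?_⟩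
        have := h1 q hq x (sub _ hx) y (sub _ hy) hqx hqy
        rw [g2 x hx y hy] at this
        push Not at this
        rw [this]
      · exact ⟨0, 0, fun x hx hqx => absurd ⟨x, hx, hqx⟩ hex⟩
    by_cases hex : ∃ c ∈ comp G X x₀, Bad G X Y (comp G X x₀) c
    · obtain ⟨c, hc, hb⟩ := hex
      have hgc := g1 c hc
      refine ⟨fun x => Equiv.swap 0 (g c) (g x), ?_, ?_, ?_, two _⟩
      · intro x hx
        have := g1 x hx
        simp only [Equiv.swap_apply_def]
        split_ifs <;> omega
      · intro x hx y hy hxy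
        have := (g2 x hx y hy).1 hxy
        exact fun h => this ((Equiv.swap 0 (g c)).injective h)
      · intro x hx hbx
        have := hst c hc x hx hb hbx
        rw [g2 c hc x hx] at this
        push Not at this
        simp [← this]
    · exact ⟨g, g1, fun x hx y hy => (g2 x hx y hy).1,
        fun c hc hb => absurd ⟨c, hc, hb⟩ hex, two (Equiv.refl _)⟩

lemma lemX (hP : NoP5 G) {X Y : Set V} {k : ℕ} (hk : 3 ≤ k) (hpaw : PawFree G X)
    (hcf : G.CliqueFreeOn X (k + 1))
    (h1 : ∀ q ∈ Y, ∀ x ∈ X, ∀ x' ∈ X, G.Adj q x → G.Adj q x' → ¬ G.Adj x x')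
    (h2 : ∀ q ∈ Y, ∀ q' ∈ Y, G.Adj q q' → ∀ x ∈ X, G.Adj q x → G.Adj q' x) :
    ∃ g : V → ℕ, (∀ x ∈ X, g x < k) ∧ (∀ x ∈ X, ∀ y ∈ X, G.Adj x y → g x ≠ g y) ∧
      ∀ q ∈ Y, ∃ a b, ∀ x ∈ X, G.Adj q x → g x = a ∨ g x = b := by
  classical
  obtain ⟨g, hg⟩ := glue (G := G) (S := X) (Φ := fun P g => (∀ x ∈ P, g x < k) ∧
      (∀ x ∈ P, ∀ y ∈ P, G.Adj x y → g x ≠ g y) ∧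
      (∀ c ∈ P, Bad G X Y P c → g c < 2) ∧
      ∀ q ∈ Y, ∃ a b, ∀ x ∈ P, G.Adj q x → g x = a ∨ g x = b)
    (fun x hx => comp_good hP hk hpaw hcf h1 h2 hx)
  refine ⟨g, ?_, ?_, ?_⟩
  · intro x hx
    obtain ⟨f, ⟨f1, -⟩, e⟩ := hg x hx
    rw [e x comp_self]; exact f1 x comp_self
  · intro x hx y hy hxy
    obtain ⟨f, ⟨-, f2, -⟩, e⟩ := hg x hx
    have hyx : y ∈ comp G X x := comp_closed comp_self hx hy hxy
    rw [e x comp_self, e y hyx]; exact f2 x comp_self y hyx hxy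
  · intro q hq
    by_cases hex : ∃ x ∈ X, ∃ y ∈ X, G.Adj q x ∧ G.Adj q y ∧ y ∉ comp G X x
    · obtain ⟨x, hx, y, hy, hqx, hqy, hyx⟩ := hex
      refine ⟨0, 1, fun z hz hqz => ?_⟩
      obtain ⟨f, ⟨-, -, f3, -⟩, e⟩ := hg z hz
      have : g z < 2 := by
        rw [e z comp_self]
        refine f3 z comp_self ⟨q, hq, hqz, ?_⟩
        by_cases hxz : x ∈ comp G X z
        · refine ⟨y, hy, fun h => hyx ?_, hqy⟩
          rw [comp_eq hxz]; exact h
        · exact ⟨x, hx, hxz, hqx⟩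
      omega
    · push Not at hex
      by_cases hne : ∃ x ∈ X, G.Adj q x
      · obtain ⟨x, hx, hqx⟩ := hne
        obtain ⟨f, ⟨-, -, -, f4⟩, e⟩ := hg x hx
        obtain ⟨a, b, hab⟩ := f4 q hq
        refine ⟨a, b, fun z hz hqz => ?_⟩
        have hzx := hex x hx z hz hqx hqz
        rw [e z hzx]; exact hab z hzx hqz
      · exact ⟨0, 0, fun x hx hqx => absurd ⟨x, hx, hqx⟩ hne⟩

end HVNProof


namespace HVNProof

variable {V : Type*} {G : SimpleGraph V} {S : Set V} {x y z : V}

lemma k4free (h : G.CliqueFree 4) {a b c d : V} (ab : G.Adj a b) (ac : G.Adj a c) (ad : G.Adj a d)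
    (bc : G.Adj b c) (bd : G.Adj b d) (cd : G.Adj c d) : False := by
  classical
  refine h {a, b, c, d} ?_
  have h3 : G.IsNClique 3 {b, c, d} := is3Clique_triple_iff.2 ⟨bc, bd, cd⟩
  refine h3.insert ?_
  intro z hz
  simp only [Finset.mem_insert, Finset.mem_singleton] at hz
  rcases hz with rfl | rfl | rfl <;> assumption

/-- Neighbours outside are shared along a component. -/
lemma comp_hom {u x₀ : V}
    (hom : ∀ x d d', x ∈ comp G S x₀ → d ∈ comp G S x₀ → d' ∈ comp G S x₀ → G.Adj u x →
      ¬ G.Adj u d → ¬ G.Adj u d' → G.Adj d d' → G.Adj x d → G.Adj x d')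
    {d d' w : V} (hd : d ∈ comp G S x₀ \ {y | G.Adj u y})
    (hd' : d' ∈ comp G (comp G S x₀ \ {y | G.Adj u y}) d)
    (hw : w ∈ comp G S x₀) (huw : G.Adj u w) (h : G.Adj w d') : G.Adj w d := by
  refine comp_iff (p := fun z => G.Adj w z) hd' comp_self ?_ h
  intro a b ha hb haD hbD hab hwa
  exact hom w a b hw haD.1 hbD.1 huw haD.2 hbD.2 hab hwa

lemma exists_nbr {D : Set V} {q : V} (h : ¬ ColOn G (comp G D q) 2) :
    ∃ d ∈ D, G.Adj q d := by
  by_contra hcon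
  push Not at hcon
  apply h
  refine ColOn.mono (ColOn.single 2 (by omega) q) ?_ le_rfl
  intro z hz
  refine comp_ind (p := fun z => z ∈ ({q} : Set V)) hz rfl ?_
  intro a b _ _ hb hab ha
  rw [Set.mem_singleton_iff] at ha
  subst ha
  exact absurd hab (hcon b hb)

lemma lemN (hP : NoP5 G) (hK : G.CliqueFree 4) (conn : ∀ x y, y ∈ comp G Set.univ x)
    {T : Set V} {t t' : V} (ht : t ∈ T) (ht' : t' ∈ T) (htt : G.Adj t t')
    (hmod : ∀ y, y ∉ T → ∀ s ∈ T, ∀ s' ∈ T, G.Adj y s → G.Adj y s') (hne : ∃ y, y ∉ T) :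
    ColOn G Set.univ 6 := by
  classical
  obtain ⟨y₀, hy₀⟩ := hne
  obtain ⟨a, s₀, -, -, -, -, has, haT, hsT⟩ := comp_cross (A := T) (conn t t) ht (conn t y₀) hy₀
  have hS : ∀ s, s ∉ T → G.Adj s t → ∀ s', s' ∉ T → G.Adj s' t → ¬ G.Adj s s' := by
    intro s hs hst s' hs' hst' hss
    exact k4free hK hst (hmod s hs t ht t' ht' hst) hss htt hst'.symm
      (hmod s' hs' t ht t' ht' hst').symm
  have hT3 : ColOn G T 3 := by
    refine TriFree.col3 hP ?_
    intro p hp q hq r hr hpq hpr hqr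
    have := hmod s₀ hsT a haT
    exact k4free hK (this p hp has.symm) (this q hq has.symm) (this r hr has.symm) hpq hpr hqr
  set Q : Set V := {y | y ∉ T ∧ ¬ G.Adj y t} with hQ
  have hQ5 : ColOn G Q 5 := by
    refine LCol.of_comps ?_
    intro y hy
    set C := comp G Q y with hC
    have hCQ : ∀ z ∈ C, z ∈ Q := fun z hz => comp_sub hy hz
    obtain ⟨w, u, -, -, -, -, hwu, hwC, huC⟩ :=
      comp_cross (A := C) (conn y y) comp_self (conn y t) (fun h => (hCQ _ h).1 ht)
    have hwQ := hCQ w hwC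
    have huT : u ∉ T := fun h => hwQ.2 (hmod w hwQ.1 u h t ht hwu)
    have hut : G.Adj u t := by
      by_contra hut
      exact huC (comp_closed hwC hwQ ⟨huT, hut⟩ hwu)
    have hom : ∀ x d d', x ∈ C → d ∈ C → d' ∈ C → G.Adj u x →
      ¬ G.Adj u d → ¬ G.Adj u d' → G.Adj d d' → G.Adj x d → G.Adj x d' := by
      intro x d d' hx hd hd' hbx hbd hbd' hdd hxd
      by_contra hxd'
      exact hP t u x d d' hut.symm hbx hxd hdd (fun h => (hCQ _ hx).2 h.symm)
        (fun h => (hCQ _ hd).2 h.symm) (fun h => (hCQ _ hd').2 h.symm) hbd hbd' hxd'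
    set D := C \ {y | G.Adj u y} with hD
    set X := {x | x ∈ C ∧ G.Adj u x} with hX
    set Y := {d | d ∈ D ∧ ¬ ColOn G (comp G D d) 2} with hY
    have hpaw : PawFree G X := fun a ha b hb c hc d _ hab hac hbc _ _ _ =>
      k4free hK ha.2 hb.2 hc.2 hab hac hbc
    obtain ⟨g, g1, g2, g3⟩ := lemX (k := 3) (X := X) (Y := Y) hP le_rfl hpaw
      hK.cliqueFreeOn (by
        intro q hq x hx x' hx' hqx hqx' hxx
        obtain ⟨d, hd, hqd⟩ := exists_nbr hq.2
        have e1 := hom x q d hx.1 hq.1.1 hd.1 hx.2 hq.1.2 hd.2 hqd hqx.symm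
        have e2 := hom x' q d hx'.1 hq.1.1 hd.1 hx'.2 hq.1.2 hd.2 hqd hqx'.symm
        exact k4free hK hqd hqx hqx' e1.symm e2.symm hxx) (by
        intro q hq q' hq' hqq x hx hqx
        exact (hom x q q' hx.1 hq.1.1 hq'.1.1 hx.2 hq.1.2 hq'.1.2 hqq hqx.symm).symm)
    have hfin : LCol G (X ∪ D) (fun _ c => c < 5) := by
      refine LCol.extend g (fun x hx => by have := g1 x hx; omega) g2 ?_
      refine LCol.of_comps ?_
      intro d hd
      by_cases hb : ColOn G (comp G D d) 2
      · obtain ⟨f, f1, f2⟩ := hb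
        refine ⟨fun z => 3 + f z, fun z hz => ⟨?_, ?_⟩, ?_⟩
        · have := f1 z hz; simp only at this ⊢; omega
        · intro x hx _
          have := g1 x hx; simp only; omega
        · intro p hp q hq hpq
          have := f2 p hp q hq hpq
          simp only; omega
      · obtain ⟨x, hx, hux, hxd⟩ := attach hwC hwu.symm hom hd.1 hd.2
        have h3 : TriFree G (comp G D d) := by
          intro a ha b hb c hc hab hac hbc
          exact k4free hK (hxd a ha) (hxd b hb) (hxd c hc) hab hac hbc
        obtain ⟨f, f1, f2⟩ := h3.col3 hP
        obtain ⟨a, b, hab⟩ := g3 d ⟨hd, hb⟩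
        obtain ⟨e, he, hea, heb⟩ : ∃ e, e < 3 ∧ e ≠ a ∧ e ≠ b := by
          by_cases h0 : (0 ≠ a ∧ 0 ≠ b)
          · exact ⟨0, by omega, h0⟩
          by_cases h0 : (1 ≠ a ∧ 1 ≠ b)
          · exact ⟨1, by omega, h0⟩
          · exact ⟨2, by omega, by omega, by omega⟩
        refine ⟨fun z => if f z = 2 then e else 3 + f z, fun z hz => ⟨?_, ?_⟩, ?_⟩
        · have := f1 z hz; simp only at this ⊢; split_ifs <;> omega
        · intro x' hx' hxz
          have hs := hab x' hx' (comp_hom hom hd hz hx'.1 hx'.2 hxz).symm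
          have := g1 x' hx'
          simp only; split_ifs <;> omega
        · intro p hp q hq hpq
          have := f2 p hp q hq hpq
          have h1 := f1 p hp
          have h2 := f1 q hq
          simp only at h1 h2 ⊢; split_ifs <;> omega
    refine LCol.mono hfin ?_ (fun _ _ _ h => h)
    intro z hz
    by_cases huz : G.Adj u z
    · exact Or.inl ⟨hz, huz⟩
    · exact Or.inr ⟨hz, huz⟩
  have hTQ : ColOn G (T ∪ Q) 5 := by
    refine ColOn.union_anti (hT3.mono le_rfl (by omega)) hQ5 ?_
    intro a ha b hb hab
    exact hb.2 (hmod b hb.1 a ha t ht hab.symm)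
  have hS1 : ColOn G {s | s ∉ T ∧ G.Adj s t} 1 := by
    refine ColOn.stable le_rfl ?_
    intro p hp q hq
    exact hS p hp.1 hp.2 q hq.1 hq.2
  refine ColOn.mono (hTQ.union hS1) ?_ le_rfl
  intro z _
  by_cases h1 : z ∈ T
  · exact Or.inl (Or.inl h1)
  · by_cases h2 : G.Adj z t
    · exact Or.inr ⟨h1, h2⟩
    · exact Or.inl (Or.inr ⟨h1, h2⟩)

end HVNProof


namespace HVNProof

variable {V : Type*} {G : SimpleGraph V} {S : Set V} {x y z : V}

/-- No induced path through the cycle. -/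
def TValid (p : ZMod 5 → Bool) : Prop :=
  ∀ i, ¬ (p i = true ∧ p (i + 1) = false ∧ p (i + 2) = false ∧ p (i + 3) = false) ∧
    ¬ (p (i + 3) = true ∧ p (i + 2) = false ∧ p (i + 1) = false ∧ p i = false)

/-- Compatibility of the types of adjacent non-neighbours of the hub. -/
def TComp (p q : ZMod 5 → Bool) : Prop :=
  ∀ i, ¬ (p i = true ∧ p (i + 1) = true ∧ q i = true ∧ q (i + 1) = true) ∧
    ¬ (p i ≠ q i ∧ p (i + 2) = false ∧ q (i + 2) = false) ∧
    ¬ (p i ≠ q i ∧ p (i + 3) = false ∧ q (i + 3) = false)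

instance (p : ZMod 5 → Bool) : Decidable (TValid p) := by unfold TValid; infer_instance
instance (p q : ZMod 5 → Bool) : Decidable (TComp p q) := by unfold TComp; infer_instance

/-- Colour of a type. -/
def colT (p : ZMod 5 → Bool) : ℕ := if p 0 = false then 0 else if p 1 = false then 1 else 2

set_option maxRecDepth 100000 in
set_option maxHeartbeats 4000000 in
lemma colT_ne : ∀ p, TValid p → ∀ q, TValid q → TComp p q → p ≠ q → colT p ≠ colT q := by
  decide +kernel

lemma self_comp : ∀ p, TComp p p → (∀ i, ¬ (p i = true ∧ p (i + 1) = true)) ∧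
    ∃ j, p j = false ∧ p (j + 1) = false := by
  decide +kernel

lemma w5 (hP : NoP5 G) (hK : G.CliqueFree 4) (conn : ∀ x y, y ∈ comp G Set.univ x)
    {v : V} (h5 : HasC5 G {y | G.Adj v y}) : ColOn G Set.univ 6 := by
  classical
  obtain ⟨f, hv, hf⟩ := h5
  replace hv : ∀ i, G.Adj v (f i) := hv
  obtain ⟨a1, a2, a3, a4⟩ := c5_facts hf
  let tp : V → ZMod 5 → Bool := fun x i => decide (G.Adj x (f i))
  have tt : ∀ x i, tp x i = true ↔ G.Adj x (f i) := fun x i => by simp [tp]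
  have tf : ∀ x i, tp x i = false ↔ ¬ G.Adj x (f i) := fun x i => by simp [tp]
  have valid : ∀ x, TValid (tp x) := by
    intro x i
    have e1 : G.Adj (f (i + 1)) (f (i + 2)) := by
      have := a1 (i + 1); rwa [show i + 1 + 1 = i + 2 by ring] at this
    have e2 : G.Adj (f (i + 2)) (f (i + 3)) := by
      have := a1 (i + 2); rwa [show i + 2 + 1 = i + 3 by ring] at this
    have e3 : ¬ G.Adj (f (i + 1)) (f (i + 3)) := by
      have := a2 (i + 1); rwa [show i + 1 + 2 = i + 3 by ring] at this
    simp only [tt, tf]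
    constructor
    · rintro ⟨h0, h1, h2, h3⟩
      exact hP x (f i) (f (i + 1)) (f (i + 2)) (f (i + 3)) h0 (a1 i) e1 e2 h1 h2 h3 (a2 i) (a3 i) e3
    · rintro ⟨h0, h1, h2, h3⟩
      exact hP x (f (i + 3)) (f (i + 2)) (f (i + 1)) (f i) h0 e2.symm e1.symm (a1 i).symm
        h1 h2 h3 (fun h => e3 h.symm) (fun h => a3 i h.symm) (fun h => a2 i h.symm)
  have hcomp : ∀ c c', ¬ G.Adj c v → ¬ G.Adj c' v → G.Adj c c' → TComp (tp c) (tp c') := by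
    have key : ∀ c c', ¬ G.Adj c v → ¬ G.Adj c' v → G.Adj c c' → ∀ i j, ¬ G.Adj (f i) (f j) →
        ¬ (tp c i ≠ tp c' i ∧ tp c j = false ∧ tp c' j = false) := by
      rintro c c' hc hc' hcc i j hij ⟨hne, h1, h2⟩
      rw [tf] at h1 h2
      by_cases hi : G.Adj c (f i)
      · by_cases hi' : G.Adj c' (f i)
        · apply hne; rw [(tt c i).2 hi, (tt c' i).2 hi']
        · exact hP c' c (f i) v (f j) hcc.symm hi (hv i).symm (hv j) hi' hc' h2 hc h1 hij
      · by_cases hi' : G.Adj c' (f i)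
        · exact hP c c' (f i) v (f j) hcc hi' (hv i).symm (hv j) hi hc h1 hc' h2 hij
        · apply hne; rw [(tf c i).2 hi, (tf c' i).2 hi']
    intro c c' hc hc' hcc i
    refine ⟨?_, key c c' hc hc' hcc i _ (a2 i), key c c' hc hc' hcc i _ (a3 i)⟩
    simp only [tt]
    rintro ⟨h1, h2, h3, h4⟩
    exact k4free hK hcc h1 h2 h3 h4 (a1 i)
  by_cases hsame : ∃ c c', ¬ G.Adj c v ∧ ¬ G.Adj c' v ∧ c ≠ v ∧ c' ≠ v ∧ G.Adj c c' ∧ tp c = tp c'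
  · obtain ⟨c, c', hc, hc', hcv, hcv', hcc, htp⟩ := hsame
    have hcp := hcomp c c' hc hc' hcc
    rw [← htp] at hcp
    obtain ⟨hst, j₀, hj0, hj1⟩ := self_comp _ hcp
    set Z : Set V := {w | ¬ G.Adj w v ∧ w ≠ v ∧ tp w = tp c} with hZ
    have hcZ : c ∈ Z := ⟨hc, hcv, rfl⟩
    have hTZ : ∀ w ∈ comp G Z c, w ∈ Z := fun w hw => comp_sub hcZ hw
    refine lemN hP hK conn (T := comp G Z c) comp_self
      (comp_closed comp_self hcZ ⟨hc', hcv', htp.symm⟩ hcc) hcc ?_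
      ⟨v, fun h => (hTZ v h).2.1 rfl⟩
    intro y hy s hs s' hs' hys
    refine comp_iff (p := fun z => G.Adj y z) hs hs' ?_ hys
    intro a b ha hb haZ hbZ hab hya
    by_contra hyb
    have hay := hya.symm
    have hby : ¬ G.Adj b y := fun h => hyb h.symm
    have na : ∀ j, tp c j = false → ¬ G.Adj a (f j) := fun j hj => by
      rw [← tf, haZ.2.2]; exact hj
    have nb : ∀ j, tp c j = false → ¬ G.Adj b (f j) := fun j hj => by
      rw [← tf, hbZ.2.2]; exact hj
    by_cases hyv : y = v
    · subst hyv; exact haZ.1 hay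
    by_cases hyv' : G.Adj y v
    · have hh : ∀ j, tp c j = false → G.Adj y (f j) := by
        intro j hj
        by_contra hyj
        exact hP b a y v (f j) hab.symm hay hyv' (hv j) hby hbZ.1 (nb j hj) haZ.1 (na j hj) hyj
      exact k4free hK hyv' (hh _ hj0) (hh _ hj1) (hv _) (hv _) (a1 _)
    · by_cases hex : ∃ j, tp c j = false ∧ G.Adj y (f j)
      · obtain ⟨j, hj, hyj⟩ := hex
        exact hP b a y (f j) v hab.symm hay hyj (hv j).symm hby (nb j hj) hbZ.1 (na j hj) haZ.1 hyv'
      · push Not at hex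
        have hyZ : y ∉ Z := fun h => hy (comp_closed ha haZ h hay)
        have hne : tp y ≠ tp c := fun h => hyZ ⟨hyv', hyv, h⟩
        obtain ⟨i, hi⟩ := Function.ne_iff.1 hne
        have hci : tp c i = true := by
          by_contra h
          rw [Bool.not_eq_true] at h
          exact hi (by rw [h, tf]; exact hex i h)
        have hyi : ¬ G.Adj y (f i) := by
          rw [← tf]; rw [hci] at hi; simpa using hi
        have hai : G.Adj a (f i) := by rw [← tt, haZ.2.2]; exact hci
        have fin : ∀ j, ¬ G.Adj (f i) (f j) → tp c j = false → False := fun j hij hj =>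
          hP y a (f i) v (f j) hya hai (hv i).symm (hv j) hyi hyv' (hex j hj) haZ.1 (na j hj) hij
        by_cases h2 : tp c (i + 2) = false
        · exact fin _ (a2 i) h2
        · rw [Bool.not_eq_false] at h2
          refine fin _ (a3 i) ?_
          have := hst (i + 2)
          rw [show i + 2 + 1 = i + 3 by ring] at this
          by_contra h3
          rw [Bool.not_eq_false] at h3
          exact this ⟨h2, h3⟩
  · have hN : ColOn G {y | G.Adj v y} 3 := by
      refine TriFree.col3 hP ?_
      intro p hp q hq r hr hpq hpr hqr
      exact k4free hK hp hq hr hpq hpr hqr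
    have hW : ColOn G {w | ¬ G.Adj w v ∧ w ≠ v} 3 := by
      refine ⟨fun w => colT (tp w), fun w _ => ?_, ?_⟩
      · simp only [colT]; split_ifs <;> omega
      · intro c hc c' hc' hcc
        refine colT_ne _ (valid c) _ (valid c') (hcomp c c' hc.1 hc'.1 hcc) ?_
        intro h
        exact hsame ⟨c, c', hc.1, hc'.1, hc.2, hc'.2, hcc, h⟩
    have hvW : ColOn G ({v} ∪ {w | ¬ G.Adj w v ∧ w ≠ v}) 3 := by
      refine ColOn.union_anti (ColOn.single _ (by omega) v) hW ?_
      intro a ha b hb hab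
      rw [Set.mem_singleton_iff] at ha
      subst ha
      exact hb.1 hab.symm
    refine ColOn.mono (hN.union hvW) ?_ le_rfl
    intro z _
    by_cases h1 : G.Adj v z
    · exact Or.inl h1
    · by_cases h2 : z = v
      · exact Or.inr (Or.inl h2)
      · exact Or.inr (Or.inr ⟨fun h => h1 h.symm, h2⟩)

lemma k4case (hP : NoP5 G) (hK : G.CliqueFree 4) (conn : ∀ x y, y ∈ comp G Set.univ x) :
    ColOn G Set.univ 6 := by
  by_cases h : ∃ v, HasC5 G {y | G.Adj v y}
  · obtain ⟨v, hv⟩ := h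
    exact w5 hP hK conn hv
  · push Not at h
    refine three_mul (k := 2) hP (by omega) ?_
    intro w _
    refine ColOn.mono (bip hP (S := {y | G.Adj w y}) ?_ (h w)) (fun z hz => hz.2) le_rfl
    intro p hp q hq r hr hpq hpr hqr
    exact k4free hK hp hq hr hpq hpr hqr

end HVNProof


namespace HVNProof

variable {V : Type*} {G : SimpleGraph V} {S : Set V} {x y z : V}

lemma avoid3 (i j l : ℕ) : ∃ a, a < 4 ∧ a ≠ i ∧ a ≠ j ∧ a ≠ l := by
  by_cases h0 : 0 ≠ i ∧ 0 ≠ j ∧ 0 ≠ l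
  · exact ⟨0, by omega, h0⟩
  by_cases h1 : 1 ≠ i ∧ 1 ≠ j ∧ 1 ≠ l
  · exact ⟨1, by omega, h1⟩
  by_cases h2 : 2 ≠ i ∧ 2 ≠ j ∧ 2 ≠ l
  · exact ⟨2, by omega, h2⟩
  · exact ⟨3, by omega, by omega, by omega, by omega⟩

lemma avoidFin {n : ℕ} (hn : 4 ≤ n) (i j l : Fin n) : ∃ a : Fin n, a ≠ i ∧ a ≠ j ∧ a ≠ l := by
  obtain ⟨a, h4, h1, h2, h3⟩ := avoid3 i j l
  exact ⟨⟨a, by omega⟩, fun h => h1 (by rw [← h]), fun h => h2 (by rw [← h]),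
    fun h => h3 (by rw [← h])⟩

lemma greedy (N : ℕ) (forb : ℕ → ℕ) (s1 s2 : ℕ) :
    ∃ h : ℕ → ℕ, (∀ i < N, ∀ j < N, h i = h j → i = j) ∧
      ∀ j < N, h j < N + 3 ∧ h j ≠ forb j ∧ h j ≠ s1 ∧ h j ≠ s2 := by
  induction N with
  | zero => exact ⟨id, by omega, by omega⟩
  | succ N ih =>
    obtain ⟨h, h1, h2⟩ := ih
    obtain ⟨c, hc, hc'⟩ : ∃ c ∈ Finset.range (N + 4),
        c ∉ (Finset.range N).image h ∪ {forb N, s1, s2} := by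
      apply Finset.exists_mem_notMem_of_card_lt_card
      rw [Finset.card_range]
      have e1 := Finset.card_union_le ((Finset.range N).image h) {forb N, s1, s2}
      have e2 : ((Finset.range N).image h).card ≤ N := by
        simpa using Finset.card_image_le (s := Finset.range N) (f := h)
      have e3 : ({forb N, s1, s2} : Finset ℕ).card ≤ 3 := Finset.card_le_three
      omega
    simp only [Finset.mem_range, Finset.mem_union, Finset.mem_image, Finset.mem_insert,
      Finset.mem_singleton, not_or, not_exists, not_and] at hc hc'
    obtain ⟨c1, c2, c3, c4⟩ := hc'
    refine ⟨fun j => if j = N then c else h j, ?_, ?_⟩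
    · intro i hi j hj hij
      simp only at hij
      split_ifs at hij with a b b
      · omega
      · exact absurd hij.symm (c1 j (by omega))
      · exact absurd hij (c1 i (by omega))
      · exact h1 i (by omega) j (by omega) hij
    · intro j hj
      by_cases a : j = N
      · subst a; simp only [if_true]; exact ⟨by omega, c2, c3, c4⟩
      · simp only [a, if_false]
        have := h2 j (by omega)
        exact ⟨by omega, this.2⟩

lemma mstruct (hH : NoHVN G) {n : ℕ} (hn : 4 ≤ n) (hcf : G.CliqueFree (n + 1))
    (hnc : ¬ G.CliqueFree n) :
    ∃ (M : Set V) (c : V → ℕ), (∀ x ∈ M, c x < n) ∧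
      (∀ x ∈ M, ∀ y ∈ M, (G.Adj x y ↔ c x ≠ c y)) ∧
      (∀ i < n, ∃ x ∈ M, c x = i) ∧
      (∀ r, r ∉ M → ∀ x ∈ M, ∀ y ∈ M, G.Adj r x → G.Adj r y → c x = c y) := by
  classical
  obtain ⟨k, hk⟩ : ∃ k : Fin n → V, ∀ i j, G.Adj (k i) (k j) ↔ i ≠ j := by
    have e := topEmbeddingOfNotCliqueFree hnc
    exact ⟨e, fun i j => by rw [e.map_adj_iff]; simp⟩
  have ka : ∀ i j, i ≠ j → G.Adj (k i) (k j) := fun i j => (hk i j).2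
  let InM : Fin n → V → Prop := fun i x => ¬ G.Adj x (k i) ∧ ∀ j, j ≠ i → G.Adj x (k j)
  have uniq : ∀ i j x, InM i x → InM j x → i = j := by
    intro i j x hi hj
    by_contra hne
    exact hj.1 (hi.2 j (Ne.symm hne))
  have fA : ∀ x a b, a ≠ b → G.Adj x (k a) → G.Adj x (k b) → ∃ i, InM i x := by
    intro x a b hab ha hb
    have : ∃ i, ¬ G.Adj x (k i) := by
      by_contra hall
      push Not at hall
      have hc : G.IsNClique n (Finset.univ.map ⟨k, fun i j hij => by
          by_contra hne
          have := ka i j hne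
          rw [hij] at this
          exact G.irrefl this⟩) := by
        constructor
        · intro p hp q hq hpq
          simp only [Finset.coe_map, Finset.coe_univ, Set.image_univ, Set.mem_range] at hp hq
          obtain ⟨i, rfl⟩ := hp
          obtain ⟨j, rfl⟩ := hq
          exact ka i j (fun h => hpq (by rw [h]))
        · simp
      refine hcf _ (hc.insert (a := x) ?_)
      intro p hp
      simp only [Finset.mem_map, Finset.mem_univ, true_and] at hp
      obtain ⟨i, rfl⟩ := hp
      exact hall i
    obtain ⟨i, hi⟩ := this
    refine ⟨i, hi, fun j hj => ?_⟩
    by_contra hxj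
    have ne : ∀ p q, G.Adj x (k p) → ¬ G.Adj x (k q) → p ≠ q := fun p q h1 h2 h =>
      h2 (h ▸ h1)
    exact hH (k a) (k b) (k i) (k j) x (ka _ _ hab) (ka _ _ (ne _ _ ha hi)) (ka _ _ (ne _ _ ha hxj))
      (ka _ _ (ne _ _ hb hi)) (ka _ _ (ne _ _ hb hxj)) (ka _ _ hj.symm) ha hb hi hxj
  have fB : ∀ i x y, InM i x → InM i y → ¬ G.Adj x y := by
    intro i x y hx hy hxy
    obtain ⟨a, ha, -, -⟩ := avoidFin hn i i i
    obtain ⟨b, hb, hba, -⟩ := avoidFin hn i a i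
    exact hH (k a) (k b) x y (k i) (ka _ _ hba.symm) (hx.2 a ha).symm (hy.2 a ha).symm
      (hx.2 b hb).symm (hy.2 b hb).symm hxy (ka _ _ ha.symm) (ka _ _ hb.symm)
      (fun h => hx.1 h.symm) (fun h => hy.1 h.symm)
  have fC : ∀ i j x y, i ≠ j → InM i x → InM j y → G.Adj x y := by
    intro i j x y hij hx hy
    by_contra hxy
    obtain ⟨a, ha, ha', -⟩ := avoidFin hn i j i
    obtain ⟨b, hb, hb', hba⟩ := avoidFin hn i j a
    exact hH (k a) (k b) x (k j) y (ka _ _ hba.symm) (hx.2 a ha).symm (ka _ _ ha')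
      (hx.2 b hb).symm (ka _ _ hb') (hx.2 j hij.symm) (hy.2 a ha') (hy.2 b hb')
      (fun h => hxy h.symm) hy.1
  have fD : ∀ r, (¬ ∃ i, InM i r) → ∀ i j x y, i ≠ j → InM i x → InM j y → G.Adj r x →
      G.Adj r y → False := by
    intro r hr i j x y hij hx hy hrx hry
    have one : ∀ a b, a ≠ b → G.Adj r (k a) → ¬ G.Adj r (k b) := fun a b hab h1 h2 =>
      hr (fA r a b hab h1 h2)
    by_cases hex : ∃ a, a ≠ i ∧ a ≠ j ∧ G.Adj r (k a)
    · obtain ⟨a, ha, ha', hra⟩ := hex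
      obtain ⟨b, hb, hb', hba⟩ := avoidFin hn i j a
      exact hH x (k a) (k b) (k j) r (hx.2 a ha) (hx.2 b hb) (hx.2 j hij.symm) (ka _ _ hba.symm)
        (ka _ _ ha') (ka _ _ hb') hrx hra (one a b hba.symm hra) (one a j ha' hra)
    · push Not at hex
      obtain ⟨a, ha, ha', -⟩ := avoidFin hn i j i
      obtain ⟨b, hb, hb', hba⟩ := avoidFin hn i j a
      exact hH x y (k a) (k b) r (fC i j x y hij hx hy) (hx.2 a ha) (hx.2 b hb) (hy.2 a ha')
        (hy.2 b hb') (ka _ _ hba.symm) hrx hry (hex a ha ha') (hex b hb hb')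
  let c : V → ℕ := fun x => if h : ∃ i, InM i x then (h.choose : ℕ) else 0
  have hc : ∀ i x, InM i x → c x = i := by
    intro i x hx
    have h : ∃ i, InM i x := ⟨i, hx⟩
    simp only [c, h, dif_pos]
    rw [uniq _ _ _ h.choose_spec hx]
  refine ⟨{x | ∃ i, InM i x}, c, ?_, ?_, ?_, ?_⟩
  · rintro x ⟨i, hi⟩
    rw [hc i x hi]; exact i.2
  · rintro x ⟨i, hi⟩ y ⟨j, hj⟩
    rw [hc i x hi, hc j y hj]
    by_cases hij : i = j
    · subst hij
      exact iff_of_false (fB i x y hi hj) (by simp)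
    · exact iff_of_true (fC i j x y hij hi hj) (fun h => hij (Fin.ext h))
  · intro i hi
    have : InM ⟨i, hi⟩ (k ⟨i, hi⟩) := ⟨G.irrefl, fun j hj => ka _ _ hj.symm⟩
    exact ⟨k ⟨i, hi⟩, ⟨_, this⟩, hc _ _ this⟩
  · rintro r hr x ⟨i, hi⟩ y ⟨j, hj⟩ hrx hry
    rw [hc i x hi, hc j y hj]
    by_contra hij
    exact fD r hr i j x y (fun h => hij (by rw [h])) hi hj hrx hry

lemma comp_comp : comp G (comp G S x) x = comp G S x := by
  ext z
  constructor
  · intro hz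
    exact comp_sub comp_self hz
  · intro hz
    refine comp_ind (p := fun z => z ∈ comp G (comp G S x) x) hz comp_self ?_
    intro a b ha haS hbS hab ha'
    exact comp_closed ha' ha (comp_closed ha haS hbS hab) hab

lemma ColOn.triFree (h : ColOn G S 2) : TriFree G S := by
  obtain ⟨f, f1, f2⟩ := h
  intro a ha b hb c hc hab hac hbc
  have := f1 a ha; have := f1 b hb; have := f1 c hc
  have := f2 a ha b hb hab; have := f2 a ha c hc hac; have := f2 b hb c hc hbc
  simp only at *
  omega

lemma big (hP : NoP5 G) (hH : NoHVN G) {N : ℕ} (hN : 3 ≤ N) (hcf : G.CliqueFree (N + 1 + 1))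
    (conn : ∀ x y, y ∈ comp G Set.univ x) {M : Set V} {cM : V → ℕ}
    (m0 : ∀ x ∈ M, cM x < N + 1)
    (m1 : ∀ x ∈ M, ∀ y ∈ M, (G.Adj x y ↔ cM x ≠ cM y))
    (m2 : ∀ i < N + 1, ∃ x ∈ M, cM x = i)
    (m3 : ∀ r, r ∉ M → ∀ x ∈ M, ∀ y ∈ M, G.Adj r x → G.Adj r y → cM x = cM y) :
    ColOn G Set.univ (N + 1 + 3) := by
  classical
  obtain ⟨mm, hmm, -⟩ := m2 0 (by omega)
  -- index function
  obtain ⟨idx, hidx⟩ : ∃ idx : V → ℕ, ∀ r, r ∉ M → ∀ m ∈ M, G.Adj m r → cM m = idx r := by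
    refine ⟨fun r => if h : ∃ m ∈ M, G.Adj m r then cM h.choose else 0, ?_⟩
    intro r hr m hm hmr
    have h : ∃ m ∈ M, G.Adj m r := ⟨m, hm, hmr⟩
    simp only [h, dif_pos]
    exact m3 r hr m hm _ h.choose_spec.1 hmr.symm h.choose_spec.2.symm
  have hfin : LCol G (M ∪ Mᶜ) (fun _ c => c < N + 1 + 3) := by
    refine LCol.extend cM (fun x hx => by have := m0 x hx; omega)
      (fun x hx y hy h => (m1 x hx y hy).1 h) ?_
    refine LCol.of_comps ?_
    intro y hy
    set C := comp G Mᶜ y with hC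
    have hCM : ∀ z ∈ C, z ∉ M := fun z hz => comp_sub hy hz
    obtain ⟨w, u, -, -, -, -, hwu, hwC, huC⟩ :=
      comp_cross (A := C) (conn y y) comp_self (conn y mm) (fun h => hCM _ h hmm)
    have huM : u ∈ M := by
      by_contra huM
      exact huC (comp_closed hwC (hCM _ hwC) huM hwu)
    have hom : ∀ x d d', x ∈ C → d ∈ C → d' ∈ C → G.Adj u x →
      ¬ G.Adj u d → ¬ G.Adj u d' → G.Adj d d' → G.Adj x d → G.Adj x d' := by
      intro x d d' hx hd hd' hux hud hud' hdd hxd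
      by_contra hxd'
      obtain ⟨l, l4, l1, l2, l3⟩ := avoid3 (cM u) (idx d) (idx d')
      obtain ⟨m, hm, rfl⟩ := m2 l (by omega)
      have hmu : G.Adj m u := (m1 m hm u huM).2 l1
      refine hP m u x d d' hmu hux hxd hdd ?_ ?_ ?_ hud hud' hxd'
      · exact fun h => l1 (m3 x (hCM _ hx) m hm u huM h.symm hux.symm)
      · exact fun h => l2 (hidx d (hCM _ hd) m hm h)
      · exact fun h => l3 (hidx d' (hCM _ hd') m hm h)
    set D := C \ {y | G.Adj u y} with hD
    set X := {x | x ∈ C ∧ G.Adj u x} with hX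
    set Y := {d | d ∈ D ∧ ¬ TriFree G (comp G D d)} with hY
    have hpaw : PawFree G X := fun a ha b hb c hc d hd hab hac hbc hda hdb hdc =>
      hH u a b c d ha.2 hb.2 hc.2 hab hac hbc hd.2.symm hda hdb hdc
    obtain ⟨g, g1, g2, g3⟩ := lemX (k := N) (X := X) (Y := Y) hP hN hpaw
      (cliqueFreeOn_nbr hcf (u := u) (fun x hx => hx.2)) (by
        intro q hq x hx x' hx' hqx hqx' hxx
        obtain ⟨d, hd, hqd⟩ := exists_nbr (D := D) (q := q) (fun h => hq.2 h.triFree)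
        have e1 := hom x q d hx.1 hq.1.1 hd.1 hx.2 hq.1.2 hd.2 hqd hqx.symm
        have e2 := hom x' q d hx'.1 hq.1.1 hd.1 hx'.2 hq.1.2 hd.2 hqd hqx'.symm
        exact hH x x' q d u hxx hqx.symm e1 hqx'.symm e2 hqd hx.2 hx'.2 hq.1.2 hd.2) (by
        intro q hq q' hq' hqq x hx hqx
        exact (hom x q q' hx.1 hq.1.1 hq'.1.1 hx.2 hq.1.2 hq'.1.2 hqq hqx.symm).symm)
    let sk : ℕ → ℕ := fun i => if i < cM u then i else i + 1
    have sk1 : ∀ i, i < N → sk i < N + 1 := by intro i hi; simp only [sk]; split_ifs <;> omega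
    have sk2 : ∀ i, sk i ≠ cM u := by intro i; simp only [sk]; split_ifs <;> omega
    have sk3 : ∀ i j, sk i = sk j → i = j := by
      intro i j; simp only [sk]; split_ifs <;> omega
    have hXD : LCol G (X ∪ D)
        (fun b c => c < N + 1 + 3 ∧ ∀ x ∈ M, G.Adj x b → cM x ≠ c) := by
      refine LCol.extend (fun x => sk (g x)) (fun x hx => ⟨?_, ?_⟩) ?_ ?_
      · have := sk1 _ (g1 x hx); omega
      · intro m hm hmx
        rw [m3 x (hCM _ hx.1) m hm u huM hmx.symm hx.2.symm]
        exact (sk2 _).symm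
      · intro x hx x' hx' hxx h
        exact g2 x hx x' hx' hxx (sk3 _ _ h)
      refine LCol.of_comps ?_
      intro d hd
      by_cases hb : TriFree G (comp G D d)
      · obtain ⟨f, f1, f2⟩ := hb.col3 hP
        refine ⟨fun z => N + 1 + f z, fun z hz => ⟨⟨?_, ?_⟩, ?_⟩, ?_⟩
        · have := f1 z hz; simp only at this ⊢; omega
        · intro m hm _
          have := m0 m hm; simp only; omega
        · intro x hx _
          have := sk1 _ (g1 x hx); simp only; omega
        · intro p hp q hq hpq
          have := f2 p hp q hq hpq
          simp only; omega
      · obtain ⟨x, hx, hux, hxd⟩ := attach hwC hwu.symm hom hd.1 hd.2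
        set P := comp G D d with hPdef
        have hPM : ∀ z ∈ P, z ∉ M := fun z hz => hCM _ (comp_sub hd hz).1
        have hpP : PawFree G P := fun a ha b hb c hc e he hab hac hbc hea heb hec =>
          hH x a b c e (hxd a ha) (hxd b hb) (hxd c hc) hab hac hbc (hxd e he).symm hea heb hec
        have hcc : comp G P d = P := comp_comp
        have hdP : d ∈ P := comp_self
        have hmulti := hpP.multi hdP (by rw [hcc]; exact hb)
        have htwo := fun a b c z => @PawFree.two V G P z d a b c hpP hdP
        rw [hcc] at hmulti htwo
        obtain ⟨gg, gg1, gg2⟩ := multi_col hmulti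
          (cliqueFreeOn_nbr hcf (u := x) (fun z hz => hxd z hz))
        have htri : ∀ p ∈ P, ∃ d' ∈ P, ∃ d'' ∈ P, G.Adj p d' ∧ G.Adj p d'' ∧ G.Adj d' d'' := by
          intro p hp
          unfold TriFree at hb
          push Not at hb
          obtain ⟨a, ha, b, hb', c, hc, hab, hac, hbc, -⟩ := hb
          rcases htwo a b c p ha hb' hc hab hac hbc hp with h | h | h
          · exact ⟨a, ha, b, hb', h.1, h.2, hab⟩
          · exact ⟨a, ha, c, hc, h.1, h.2, hac⟩
          · exact ⟨b, hb', c, hc, h.1, h.2, hbc⟩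
        have claim : ∀ p ∈ P, ∀ e ∈ P, gg p = gg e → ∀ m ∈ M, ∀ m' ∈ M, G.Adj m p → G.Adj m' e →
            cM m = cM m' := by
          intro p hp e he hpe m hm m' hm' hmp hme
          by_contra hne
          have npe : ¬ G.Adj p e := fun h => (gg2 p hp e he).1 h hpe
          have nme : ¬ G.Adj m e := fun h => hne (m3 e (hPM _ he) m hm m' hm' h.symm hme.symm)
          have tr : ∀ q ∈ P, G.Adj p q → G.Adj q e := by
            intro q hq hpq
            rw [gg2 q hq e he, ← hpe]
            exact ((gg2 p hp q hq).1 hpq).symm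
          have adj : ∀ q ∈ P, G.Adj p q → G.Adj m q := by
            intro q hq hpq
            by_contra hmq
            obtain ⟨l, l4, l1, l2, l3⟩ := avoid3 (cM m) (cM m') (idx q)
            obtain ⟨ml, hml, rfl⟩ := m2 l (by omega)
            refine hP ml m p q e ((m1 ml hml m hm).2 l1) hmp hpq (tr q hq hpq) ?_ ?_ ?_
              hmq nme npe
            · exact fun h => l1 (m3 p (hPM _ hp) ml hml m hm h.symm hmp.symm)
            · exact fun h => l3 (hidx q (hPM _ hq) ml hml h)
            · exact fun h => l2 (m3 e (hPM _ he) ml hml m' hm' h.symm hme.symm)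
          obtain ⟨d', hd', d'', hd'', h1, h2, h3⟩ := htri p hp
          have hmx : G.Adj m x := by
            by_contra hmx
            exact hH d' d'' x e m h3 (hxd _ hd').symm (tr _ hd' h1) (hxd _ hd'').symm
              (tr _ hd'' h2) (hxd _ he) (adj _ hd' h1) (adj _ hd'' h2) hmx nme
          exact hH d' x m p e (hxd _ hd').symm (adj _ hd' h1).symm h1.symm hmx.symm (hxd _ hp) hmp
            (tr _ hd' h1).symm (hxd _ he).symm (fun h => nme h.symm) (fun h => npe h.symm)
        have hforb : ∀ j, ∃ fb, ∀ p ∈ P, gg p = j → ∀ m ∈ M, G.Adj m p → cM m = fb := by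
          intro j
          by_cases hex : ∃ p ∈ P, gg p = j ∧ ∃ m ∈ M, G.Adj m p
          · obtain ⟨p, hp, hpj, m, hm, hmp⟩ := hex
            exact ⟨cM m, fun e he hej m' hm' hme =>
              claim e he p hp (by rw [hej, hpj]) m' hm' m hm hme hmp⟩
          · exact ⟨0, fun p hp hpj m hm hmp => absurd ⟨p, hp, hpj, m, hm, hmp⟩ hex⟩
        choose forb hforb using hforb
        obtain ⟨a, b, hab⟩ := g3 d ⟨hd, hb⟩
        obtain ⟨h, hinj, hh⟩ := greedy N forb (sk a) (sk b)
        refine ⟨fun z => h (gg z), fun z hz => ⟨⟨?_, ?_⟩, ?_⟩, ?_⟩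
        · have := (hh _ (gg1 z hz)).1; simp only; omega
        · intro m hm hmz
          rw [hforb (gg z) z hz rfl m hm hmz]
          exact (hh _ (gg1 z hz)).2.1.symm
        · intro x' hx' hxz
          have hs := hab x' hx' (comp_hom hom hd hz hx'.1 hx'.2 hxz).symm
          have := (hh _ (gg1 z hz)).2.2
          rcases hs with hs | hs <;> simp only [hs]
          · exact this.1.symm
          · exact this.2.symm
        · intro p hp q hq hpq heq
          exact (gg2 p hp q hq).1 hpq (hinj _ (gg1 p hp) _ (gg1 q hq) heq)
    refine LCol.mono hXD ?_ (fun _ _ _ h => h)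
    intro z hz
    by_cases huz : G.Adj u z
    · exact Or.inl ⟨hz, huz⟩
    · exact Or.inr ⟨hz, huz⟩
  refine LCol.mono hfin ?_ (fun _ _ _ h => h)
  intro z _
  exact Classical.em _

/-- The connected case. -/
lemma connected_case (hP : NoP5 G) (hH : NoHVN G) {n : ℕ} (hcf : G.CliqueFree (n + 1))
    (conn : ∀ x y, y ∈ comp G Set.univ x) : ColOn G Set.univ (n + 3) := by
  induction n with
  | zero =>
    refine ColOn.mono (ColOn.stable le_rfl (S := Set.univ) ?_) le_rfl (k := 1) (by omega)
    intro x
    exact absurd (by simp) (hcf {x})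
  | succ n ih =>
    by_cases h : G.CliqueFree (n + 1)
    · exact (ih h).mono le_rfl (by omega)
    · by_cases hn : 4 ≤ n + 1
      · obtain ⟨M, c, m0, m1, m2, m3⟩ := mstruct hH hn hcf h
        exact big hP hH (by omega) hcf conn m0 m1 m2 m3
      · by_cases hn3 : n = 2
        · subst hn3
          exact k4case hP hcf conn
        · have hc3 : G.CliqueFree 3 := hcf.mono (by omega)
          refine ColOn.mono (TriFree.col3 hP ?_) le_rfl (k := 3) (by omega)
          intro a _ b _ c _ hab hac hbc
          classical
          exact hc3 {a, b, c} (is3Clique_triple_iff.2 ⟨hab, hac, hbc⟩)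

end HVNProof

namespace HVNProof

lemma induced_aux {V : Type*} {G : SimpleGraph V} {H : SimpleGraph (Fin 5)}
    (hH : InducedFree G H) (f : Fin 5 → V) (hf : ∀ i j, H.Adj i j ↔ G.Adj (f i) (f j))
    (tw : ∀ i j, (∀ k, H.Adj i k ↔ H.Adj j k) → i = j) : False := by
  refine hH ⟨⟨f, ?_⟩, hf⟩
  intro i j hij
  refine tw i j (fun k => ?_)
  rw [hf, hf, hij]

lemma noP5_of {V : Type*} {G : SimpleGraph V} (h : InducedFree G (pathGraph 5)) : NoP5 G := by
  intro a b c d e h1 h2 h3 h4 n1 n2 n3 n4 n5 n6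
  refine induced_aux h ![a, b, c, d, e] ?_ ?_
  · intro i j
    rw [pathGraph_adj]
    have g1 := h1.symm; have g2 := h2.symm; have g3 := h3.symm; have g4 := h4.symm
    have m1 := fun h => n1 (G.adj_symm h); have m2 := fun h => n2 (G.adj_symm h)
    have m3 := fun h => n3 (G.adj_symm h); have m4 := fun h => n4 (G.adj_symm h)
    have m5 := fun h => n5 (G.adj_symm h); have m6 := fun h => n6 (G.adj_symm h)
    fin_cases i <;> fin_cases j <;>
      first
      | exact iff_of_true (by decide) (by assumption)
      | exact iff_of_false (by decide) (by first | assumption | exact G.irrefl)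
  · simp only [pathGraph_adj]
    decide

lemma noHVN_of {V : Type*} {G : SimpleGraph V} (h : InducedFree G hvnGraph) : NoHVN G := by
  intro a b c d e h1 h2 h3 h4 h5 h6 h7 h8 n1 n2
  have hadj : ∀ i j : Fin 5, hvnGraph.Adj i j ↔ (i ≠ j ∧ ¬ ((i = 4 ∧ (j = 2 ∨ j = 3)) ∨
      (j = 4 ∧ (i = 2 ∨ i = 3)))) := by
    intro i j
    simp only [hvnGraph, fromEdgeSet_adj, Set.mem_insert_iff, Set.mem_singleton_iff, Sym2.eq_iff]
    revert i j
    decide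
  refine induced_aux h ![a, b, c, d, e] ?_ ?_
  · intro i j
    rw [hadj]
    have g1 := h1.symm; have g2 := h2.symm; have g3 := h3.symm; have g4 := h4.symm
    have g5 := h5.symm; have g6 := h6.symm; have g7 := h7.symm; have g8 := h8.symm
    have m1 := fun h => n1 (G.adj_symm h); have m2 := fun h => n2 (G.adj_symm h)
    fin_cases i <;> fin_cases j <;>
      first
      | exact iff_of_true (by decide) (by assumption)
      | exact iff_of_false (by decide) (by first | assumption | exact G.irrefl)
  · simp only [hadj]
    decide

lemma conn_of {V : Type*} {G : SimpleGraph V} (h : G.Preconnected) (x y : V) :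
    y ∈ comp G Set.univ x := by
  obtain ⟨p⟩ := h x y
  induction p with
  | nil => exact comp_self
  | cons hadj _ ih => exact Relation.ReflTransGen.head ⟨hadj, trivial, trivial⟩ ih

lemma main_colorable {V : Type*} {G : SimpleGraph V} (hP : NoP5 G) (hH : NoHVN G) {n : ℕ}
    (hcf : G.CliqueFree (n + 1)) : G.Colorable (n + 3) := by
  rw [colorable_iff_forall_connectedComponent]
  intro C
  have hP' : NoP5 C.toSimpleGraph := fun a b c d e => hP a b c d e
  have hH' : NoHVN C.toSimpleGraph := fun a b c d e => hH a b c d e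
  have hcf' : C.toSimpleGraph.CliqueFree (n + 1) :=
    hcf.comap ⟨(Embedding.induce C.supp).toCopy⟩
  obtain ⟨f, f1, f2⟩ := connected_case hP' hH' hcf'
    (conn_of C.connected_toSimpleGraph.preconnected)
  exact ⟨Coloring.mk (fun x => (⟨f x, f1 x trivial⟩ : Fin (n + 3)))
    (fun {x y} hxy h => f2 x trivial y trivial hxy (by simpa using h))⟩

end HVNProof

/-- Every (P₅, HVN)-free graph satisfies χ(G) ≤ ω(G) + 3. -/
theorem chi_le_omega_add_three {V : Type*} [Fintype V] (G : SimpleGraph V)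
    (hP5 : InducedFree G (pathGraph 5)) (hHVN : InducedFree G hvnGraph) :
    G.chromaticNumber ≤ (G.cliqueNum + 3 : ℕ) := by
  refine Colorable.chromaticNumber_le ?_
  refine HVNProof.main_colorable (HVNProof.noP5_of hP5) (HVNProof.noHVN_of hHVN) ?_
  intro t ht
  have h1 := SimpleGraph.IsClique.card_le_cliqueNum (tc := ht.1)
  have h2 := ht.2
  omega
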